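/- arXiv:0906.1957 — 3 statements merged into one kernel-verified Lean document; each statement's English description precedes it below -/
import Mathlib

section
/- Let c, θ ∈ ℝ with c ≠ 0, θ ≠ 0, and θ ≠ 1. Then every sequence f : ℕ → ℂ satisfying f(n) = exp(c·n^θ) for all n ≥ 1 is not holonomic. In particular the sequences (e^{√n})_{n≥1}, (e^{−√n})_{n≥1}, (e^{1/n})_{n≥1}, and (e^{−1/n})_{n≥1} are not holonomic. -/
/-- A sequence `f : ℕ → ℂ` is *holonomic* (P-recursive) if there exist `d ∈ ℕ`,
polynomials `p_0, …, p_d ∈ ℂ[X]`, not all zero, and `N ∈ ℕ` such that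
`∑_{k=0}^d p_k(n) · f(n+k) = 0` for all `n ≥ N`. -/
def IsHolonomic (f : ℕ → ℂ) : Prop :=
  ∃ (d N : ℕ) (p : Fin (d + 1) → Polynomial ℂ),
    (∃ k, p k ≠ 0) ∧
    ∀ n : ℕ, N ≤ n → ∑ k : Fin (d + 1), (p k).eval (n : ℂ) * f (n + (k : ℕ)) = 0

open Filter Topology Polynomial

lemma poly_reim (p : ℂ[X]) : ∃ a b : ℝ[X],
    p = a.map Complex.ofRealHom + C Complex.I * b.map Complex.ofRealHom := by
  induction p using Polynomial.induction_on' with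
  | add p q hp hq =>
    obtain ⟨a, b, rfl⟩ := hp
    obtain ⟨a', b', rfl⟩ := hq
    refine ⟨a + a', b + b', ?_⟩
    simp only [Polynomial.map_add]; ring
  | monomial n z =>
    refine ⟨monomial n z.re, monomial n z.im, ?_⟩
    simp only [map_monomial, C_mul_monomial, Complex.ofRealHom_eq_coe]
    rw [← map_add, mul_comm, Complex.re_add_im]

lemma shift_zero (e : ℕ → ℝ) : ∀ (d N : ℕ) (p : ℕ → ℝ[X]), (∃ k ≤ d, p k ≠ 0) →
    (∀ n : ℕ, N ≤ n → ∑ k ∈ Finset.range (d + 1), (p k).eval (n : ℝ) * e (n + k) = 0) →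
    ∃ (d N : ℕ) (p : ℕ → ℝ[X]), p 0 ≠ 0 ∧
    (∀ n : ℕ, N ≤ n → ∑ k ∈ Finset.range (d + 1), (p k).eval (n : ℝ) * e (n + k) = 0) := by
  intro d
  induction d with
  | zero =>
    rintro N p ⟨k, hk, hp⟩ h
    obtain rfl : k = 0 := by omega
    exact ⟨0, N, p, hp, h⟩
  | succ d ih =>
    rintro N p ⟨k, hk, hp⟩ h
    by_cases h0 : p 0 = 0
    · have hk0 : k ≠ 0 := by rintro rfl; exact hp h0
      obtain ⟨k, rfl⟩ := Nat.exists_eq_succ_of_ne_zero hk0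
      refine ih (N + 1) (fun j => (p (j + 1)).comp (X - 1)) ⟨k, by omega, ?_⟩ ?_
      · intro hz
        apply hp
        have : ((p (k + 1)).comp (X - 1)).comp (X + 1) = 0 := by
          rw [hz]; simp
        rw [comp_assoc] at this
        simpa using this
      · intro n hn
        obtain ⟨m, rfl⟩ : ∃ m, n = m + 1 := ⟨n - 1, by omega⟩
        have := h m (by omega)
        rw [Finset.sum_range_succ'] at this
        simp only [h0, eval_zero, zero_mul, add_zero] at this
        rw [← this]
        refine Finset.sum_congr rfl fun j _ => ?_
        simp only [eval_comp, eval_sub, eval_X, eval_one]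
        push_cast
        rw [show m + 1 + j = m + (j + 1) by ring]
        simp
    · exact ⟨d + 1, N, p, h0, h⟩

lemma real_rec (f : ℕ → ℂ) (e : ℕ → ℝ) (hfe : ∀ n, 1 ≤ n → f n = (e n : ℂ))
    (h : IsHolonomic f) : ∃ (d N : ℕ) (p : ℕ → ℝ[X]), p 0 ≠ 0 ∧
    (∀ n : ℕ, N ≤ n → ∑ k ∈ Finset.range (d + 1), (p k).eval (n : ℝ) * e (n + k) = 0) := by
  obtain ⟨d, N, p, ⟨k, hk⟩, h⟩ := h
  choose a b hab using fun k => poly_reim (p k)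
  have key : ∀ n : ℕ, N + 1 ≤ n →
      ∑ k : Fin (d + 1), (a k).eval (n : ℝ) * e (n + k) = 0 ∧
      ∑ k : Fin (d + 1), (b k).eval (n : ℝ) * e (n + k) = 0 := by
    intro n hn
    have h1 := h n (by omega)
    have h2 : ∑ k : Fin (d + 1), (p k).eval (n : ℂ) * f (n + (k : ℕ)) =
        ((∑ k : Fin (d + 1), (a k).eval (n : ℝ) * e (n + k) : ℝ) : ℂ) +
        Complex.I * ((∑ k : Fin (d + 1), (b k).eval (n : ℝ) * e (n + k) : ℝ) : ℂ) := by
      push_cast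
      rw [Finset.mul_sum, ← Finset.sum_add_distrib]
      refine Finset.sum_congr rfl fun j _ => ?_
      rw [hfe _ (by omega), hab j]
      have hev : ∀ q : ℝ[X], (q.map Complex.ofRealHom).eval (n : ℂ) = ((q.eval (n : ℝ) : ℝ) : ℂ) := by
        intro q
        simp
      simp only [eval_add, eval_mul, eval_C, hev]
      ring
    rw [h1] at h2
    have h3 := congrArg Complex.re h2
    have h4 := congrArg Complex.im h2
    simp only [Complex.add_re, Complex.add_im, Complex.mul_re, Complex.mul_im, Complex.I_re, Complex.I_im,
      Complex.ofReal_re, Complex.ofReal_im, Complex.zero_re, Complex.zero_im] at h3 h4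
    constructor <;> linarith
  have fin : ∀ q : Fin (d + 1) → ℝ[X], q k ≠ 0 →
      (∀ n : ℕ, N + 1 ≤ n → ∑ k : Fin (d + 1), (q k).eval (n : ℝ) * e (n + k) = 0) →
      ∃ (d N : ℕ) (p : ℕ → ℝ[X]), p 0 ≠ 0 ∧
      (∀ n : ℕ, N ≤ n → ∑ k ∈ Finset.range (d + 1), (p k).eval (n : ℝ) * e (n + k) = 0) := by
    intro q hq hs
    refine shift_zero e d (N + 1) (fun j => if hj : j < d + 1 then q ⟨j, hj⟩ else 0)
      ⟨k, by omega, by rw [dif_pos k.2]; exact hq⟩ ?_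
    intro n hn
    rw [Finset.sum_range, ← hs n hn]
    refine Finset.sum_congr rfl fun j _ => ?_
    rw [dif_pos j.2]
  by_cases ha : a k = 0
  · by_cases hb : b k = 0
    · exact absurd (by rw [hab k, ha, hb]; simp) hk
    · exact fin b hb fun n hn => (key n hn).2
  · exact fin a ha fun n hn => (key n hn).1

lemma poly_mul_exp_tendsto (p : ℝ[X]) (a β : ℝ) (ha : 0 < a) (hβ : 0 < β) :
    Tendsto (fun x : ℝ => |p.eval x| * Real.exp (-a * x ^ β)) atTop (𝓝 0) := by
  have h1 : ∀ m : ℕ, Tendsto (fun x : ℝ => x ^ m * Real.exp (-a * x ^ β)) atTop (𝓝 0) := by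
    intro m
    have := (tendsto_rpow_mul_exp_neg_mul_atTop_nhds_zero (m / β) a ha).comp (tendsto_rpow_atTop hβ)
    refine this.congr' ?_
    filter_upwards [eventually_gt_atTop 0] with x hx
    simp only [Function.comp]
    rw [← Real.rpow_mul hx.le, mul_div_cancel₀ _ hβ.ne', Real.rpow_natCast]
  have h2 : Tendsto (fun x : ℝ => p.eval x * Real.exp (-a * x ^ β)) atTop (𝓝 0) := by
    induction p using Polynomial.induction_on' with
    | add p q hp hq => simpa [add_mul] using hp.add hq
    | monomial n r => simpa [mul_assoc] using (h1 n).const_mul r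
  simpa [abs_mul] using h2.abs

lemma rpow_gap (θ : ℝ) (hθ : 1 < θ) (x : ℝ) (hx : 0 < x) (j k : ℕ) (hjk : j < k) :
    x ^ (θ - 1) ≤ (x + k) ^ θ - (x + j) ^ θ := by
  have hxj : 0 < x + j := by positivity
  have hkj : (1 : ℝ) ≤ k - j := by
    have : ((j + 1 : ℕ) : ℝ) ≤ k := by exact_mod_cast hjk
    push_cast at this; linarith
  have h := one_add_mul_self_le_rpow_one_add (s := (k - j) / (x + j)) (by
    have : 0 ≤ ((k : ℝ) - j) / (x + j) := by positivity
    linarith) hθ.le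
  have e1 : x + k = (x + j) * (1 + (k - j) / (x + j)) := by field_simp; ring
  rw [e1, Real.mul_rpow hxj.le (by positivity)]
  have h3 : x ^ (θ - 1) ≤ (x + j) ^ (θ - 1) :=
    Real.rpow_le_rpow hx.le (by simp) (by linarith)
  have h4 : (x + j) ^ θ = (x + j) ^ (θ - 1) * (x + j) := by
    rw [← Real.rpow_add_one hxj.ne']; ring_nf
  have h5 : (x + j) ^ θ * (1 + θ * ((k - j) / (x + j))) ≤ (x + j) ^ θ * (1 + (k - j) / (x + j)) ^ θ := by
    gcongr
  have h6 : (x + j) ^ θ * (1 + θ * ((k - j) / (x + j))) =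
     (x + j) ^ θ + (x + j) ^ (θ - 1) * (θ * (k - j)) := by
    rw [h4]; field_simp
  have h7 : (x + j) ^ (θ - 1) * 1 ≤ (x + j) ^ (θ - 1) * (θ * (k - j)) := by
    gcongr
    nlinarith
  linarith

lemma poly_lower (p : ℝ[X]) (hp : p ≠ 0) : ∃ δ > 0, ∀ᶠ x : ℝ in atTop, δ ≤ |p.eval x| := by
  by_cases h : p.natDegree = 0
  · obtain ⟨r, rfl⟩ := natDegree_eq_zero.1 h
    have : r ≠ 0 := by rintro rfl; simp at hp
    exact ⟨|r|, by positivity, by simp⟩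
  · have := Polynomial.abs_tendsto_atTop p (natDegree_pos_iff_degree_pos.1 (by omega))
    exact ⟨1, one_pos, this.eventually_ge_atTop 1⟩

lemma big_theta (c θ : ℝ) (hc : c ≠ 0) (hθ : 1 < θ) (d N : ℕ) (p : ℕ → ℝ[X]) (hp : p 0 ≠ 0)
    (h : ∀ n : ℕ, N ≤ n → ∑ k ∈ Finset.range (d + 1),
      (p k).eval (n : ℝ) * Real.exp (c * ((n + k : ℕ) : ℝ) ^ θ) = 0) : False := by
  classical
  -- dominant index
  obtain ⟨K, hK, hpK, hdom⟩ : ∃ K ∈ Finset.range (d + 1), p K ≠ 0 ∧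
      ∀ k ∈ Finset.range (d + 1), k ≠ K → p k = 0 ∨ ∀ x : ℝ, 0 < x →
        c * (x + k) ^ θ - c * (x + K) ^ θ ≤ -|c| * x ^ (θ - 1) := by
    rcases lt_or_gt_of_ne hc with hneg | hpos
    · refine ⟨0, by simp, hp, fun k _ hk => Or.inr fun x hx => ?_⟩
      have := rpow_gap θ hθ x hx 0 k (by omega)
      rw [abs_of_neg hneg]
      nlinarith
    · have hne : ((Finset.range (d + 1)).filter fun k => p k ≠ 0).Nonempty :=
        ⟨0, by simp [hp]⟩
      have hm := Finset.max'_mem _ hne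
      refine ⟨_, (Finset.mem_filter.1 hm).1, (Finset.mem_filter.1 hm).2, fun k hk hkK => ?_⟩
      by_cases hz : p k = 0
      · exact Or.inl hz
      · right
        intro x hx
        have hle := Finset.le_max' ((Finset.range (d + 1)).filter fun k => p k ≠ 0) k
          (Finset.mem_filter.2 ⟨hk, hz⟩)
        have := rpow_gap θ hθ x hx k _ (lt_of_le_of_ne hle hkK)
        rw [abs_of_pos hpos]
        nlinarith
  obtain ⟨δ, hδ, hev⟩ := poly_lower _ hpK
  have hsm : Tendsto (fun x : ℝ => ∑ k ∈ (Finset.range (d + 1)).erase K,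
      |(p k).eval x| * Real.exp (-|c| * x ^ (θ - 1))) atTop (𝓝 0) := by
    have := tendsto_finsetSum (f := fun k (x : ℝ) => |(p k).eval x| * Real.exp (-|c| * x ^ (θ - 1)))
      ((Finset.range (d + 1)).erase K) (fun k _ => poly_mul_exp_tendsto (p k) |c| (θ - 1)
      (abs_pos.2 hc) (by linarith))
    simpa using this
  have hall := (hev.and (hsm.eventually_lt_const hδ)).and (eventually_gt_atTop 0)
  have hall' := tendsto_natCast_atTop_atTop (R := ℝ) |>.eventually hall
  obtain ⟨n, ⟨⟨h1, h2⟩, h3⟩, hn⟩ := (hall'.and (eventually_ge_atTop N)).exists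
  have h0 := h n hn
  rw [← Finset.add_sum_erase _ _ hK] at h0
  set E := Real.exp (c * ((n + K : ℕ) : ℝ) ^ θ) with hE
  have hEpos : 0 < E := Real.exp_pos _
  have hle : |∑ k ∈ (Finset.range (d + 1)).erase K, (p k).eval (n : ℝ) * Real.exp (c * ((n + k : ℕ) : ℝ) ^ θ)|
      ≤ (∑ k ∈ (Finset.range (d + 1)).erase K, |(p k).eval (n:ℝ)| * Real.exp (-|c| * (n:ℝ) ^ (θ - 1))) * E := by
    refine (Finset.abs_sum_le_sum_abs _ _).trans ?_
    rw [Finset.sum_mul]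
    refine Finset.sum_le_sum fun k hk => ?_
    rw [Finset.mem_erase] at hk
    rcases hdom k hk.2 hk.1 with hz | hz
    · simp [hz]
    · rw [abs_mul, abs_of_pos (Real.exp_pos _), mul_assoc]
      gcongr
      rw [hE, ← Real.exp_add]
      have := hz n h3
      push_cast
      gcongr
      linarith
  have h4 : |(p K).eval (n : ℝ) * E| = |∑ k ∈ (Finset.range (d + 1)).erase K, (p k).eval (n : ℝ) * Real.exp (c * ((n + k : ℕ) : ℝ) ^ θ)| := by
    rw [eq_neg_of_add_eq_zero_left h0, abs_neg]
  rw [abs_mul, abs_of_pos hEpos] at h4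
  have : δ * E < δ * E := by
    calc δ * E ≤ |(p K).eval (n : ℝ)| * E := by gcongr
      _ ≤ _ := h4.le.trans hle
      _ < δ * E := by gcongr
  exact lt_irrefl _ this

lemma rpow_analytic (θ : ℝ) (g : ℝ → ℝ) (x : ℝ) (hg : AnalyticAt ℝ g x) (hx : 0 < g x) :
    AnalyticAt ℝ (fun v => (g v) ^ θ) x := by
  have h : AnalyticAt ℝ (fun v => Real.exp (Real.log (g v) * θ)) x :=
    ((hg.log hx).mul analyticAt_const).rexp
  refine h.congr ?_
  filter_upwards [hg.continuousAt.eventually (lt_mem_nhds hx)] with v hv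
  rw [Real.rpow_def_of_pos hv]

noncomputable def gfun (θ : ℝ) (k : ℕ) : ℝ → ℝ := dslope (fun v : ℝ => (1 + k * v) ^ θ) 0

lemma gfun_analytic (θ : ℝ) (k : ℕ) : AnalyticAt ℝ (gfun θ k) 0 := by
  have h : AnalyticAt ℝ (fun v : ℝ => (1 + k * v) ^ θ) 0 :=
    rpow_analytic θ (fun v => 1 + k * v) 0 (by fun_prop) (by simp)
  obtain ⟨p, hp⟩ := h
  exact ⟨_, hp.has_fpower_series_dslope_fslope⟩

lemma gfun_spec (θ : ℝ) (k : ℕ) (v : ℝ) : v * gfun θ k v = (1 + k * v) ^ θ - 1 := by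
  have := sub_smul_dslope (fun v : ℝ => (1 + k * v) ^ θ) 0 v
  simpa [gfun] using this

lemma poly_analytic (p : ℝ[X]) (x : ℝ) : AnalyticAt ℝ (fun v => p.eval v) x := by
  have := AnalyticAt.aeval_polynomial (analyticAt_id (𝕜 := ℝ) (z := x)) p
  simpa using this

lemma transform (c θ : ℝ) (d : ℕ) (p : ℕ → ℝ[X]) : ∃ (D : ℕ) (P : ℕ → ℝ[X]),
    (∀ k ∈ Finset.range (d + 1), ∀ v : ℝ, 0 < v → (P k).eval v = v ^ D * (p k).eval v⁻¹) ∧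
    ∀ v : ℝ, 0 < v → ∑ k ∈ Finset.range (d + 1), (P k).eval v * Real.exp (c * (v ^ (1 - θ) * gfun θ k v))
      = v ^ D * Real.exp (-(c * (v⁻¹) ^ θ)) *
        ∑ k ∈ Finset.range (d + 1), (p k).eval v⁻¹ * Real.exp (c * (v⁻¹ + k) ^ θ) := by
  have hP : ∀ k ∈ Finset.range (d + 1), ∀ v : ℝ, 0 < v →
      (reflect ((Finset.range (d + 1)).sup fun k => (p k).natDegree) (p k)).eval v =
      v ^ ((Finset.range (d + 1)).sup fun k => (p k).natDegree) * (p k).eval v⁻¹ := by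
    intro k hk v hv
    have hle : (p k).natDegree ≤ (Finset.range (d + 1)).sup fun k => (p k).natDegree :=
      Finset.le_sup (f := fun k => (p k).natDegree) hk
    generalize (Finset.range (d + 1)).sup (fun k => (p k).natDegree) = D at hle
    let _ : Invertible v⁻¹ := invertibleOfNonzero (by positivity)
    have := eval₂_reflect_mul_pow (RingHom.id ℝ) v⁻¹ D (p k) hle
    simp only [invOf_eq_inv, inv_inv, eval₂_id, inv_pow] at this
    rw [← this]; field_simp
  refine ⟨_, fun k => reflect ((Finset.range (d + 1)).sup fun k => (p k).natDegree) (p k), hP, ?_⟩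
  intro v hv
  rw [Finset.mul_sum]
  refine Finset.sum_congr rfl fun k hk => ?_
  rw [hP k hk v hv]
  have : Real.exp (c * (v ^ (1 - θ) * gfun θ k v)) =
      Real.exp (-(c * (v⁻¹) ^ θ)) * Real.exp (c * (v⁻¹ + k) ^ θ) := by
    rw [← Real.exp_add]
    congr 1
    have h1 : v⁻¹ + k = v⁻¹ * (1 + k * v) := by field_simp
    rw [h1, Real.mul_rpow (by positivity) (by positivity), sub_eq_add_neg 1 θ,
      Real.rpow_add hv, Real.rpow_one, Real.inv_rpow hv.le, Real.rpow_neg hv.le]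
    have := gfun_spec θ k v
    linear_combination c * (v ^ θ)⁻¹ * this
  rw [this]; ring

lemma dominance (α : ℝ) (hα : 0 < α) (hirr : Irrational α) (φ : ℕ → ℝ → ℝ)
    (hφ : ∀ i, AnalyticAt ℝ (φ i) 0) (Φ : ℝ → ℝ)
    (hΦ : ∀ I : ℕ, (fun v => Φ v - ∑ i ∈ Finset.range I, (v ^ α) ^ i * φ i v)
      =O[𝓝[>] 0] fun v => (v ^ α) ^ I)
    (hz : ∃ᶠ v in 𝓝[>] (0 : ℝ), Φ v = 0) (i : ℕ) : ∀ᶠ v in 𝓝 0, φ i v = 0 := by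
  classical
  by_contra hi
  have hord : ∀ i, ¬ (∀ᶠ v in 𝓝 0, φ i v = 0) → ∃ (n : ℕ) (g : ℝ → ℝ), AnalyticAt ℝ g 0 ∧ g 0 ≠ 0 ∧
      ∀ᶠ z in 𝓝 0, φ i z = z ^ n * g z := by
    intro i h
    simpa using (hφ i).exists_eventuallyEq_pow_smul_nonzero_iff.2 h
  choose! m u hu hu0 hmu using hord
  obtain ⟨I, hI⟩ := exists_nat_gt ((α * i + m i) / α)
  rw [div_lt_iff₀ hα] at hI
  have hiI : i < I := by
    by_contra hle
    have : (I : ℝ) ≤ i := by exact_mod_cast not_lt.1 hle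
    have : (I : ℝ) * α ≤ i * α := by gcongr
    have : (0 : ℝ) ≤ m i := by positivity
    linarith
  let S := (Finset.range I).filter fun i => ¬ (∀ᶠ v in 𝓝 0, φ i v = 0)
  have hiS : i ∈ S := by simp only [S, Finset.mem_filter, Finset.mem_range]; exact ⟨hiI, hi⟩
  obtain ⟨j, hjS, hj⟩ := Finset.exists_min_image S (fun i => α * i + m i) ⟨i, hiS⟩
  have hjS' := Finset.mem_filter.1 hjS
  set E := α * j + m j with hE
  have hEI : E < α * I := by have := hj i hiS; linarith
  have tend0 : ∀ β : ℝ, 0 < β → Tendsto (fun v : ℝ => v ^ β) (𝓝[>] 0) (𝓝 0) := by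
    intro β hβ
    have h := (Real.continuousAt_rpow_const 0 β (Or.inr hβ.le)).tendsto
    rw [Real.zero_rpow hβ.ne'] at h
    exact h.mono_left nhdsWithin_le_nhds
  have hpos : ∀ᶠ v : ℝ in 𝓝[>] 0, 0 < v := self_mem_nhdsWithin
  -- each term
  have term : ∀ i, ¬ (∀ᶠ v in 𝓝 0, φ i v = 0) →
      (fun v : ℝ => v ^ (-E) * ((v ^ α) ^ i * φ i v)) =ᶠ[𝓝[>] 0]
        fun v => v ^ (α * i + m i - E) * u i v := by
    intro i hi
    filter_upwards [hpos, nhdsWithin_le_nhds (hmu i hi)] with v hv hv2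
    rw [hv2, ← Real.rpow_natCast (v ^ α) i, ← Real.rpow_mul hv.le, ← Real.rpow_natCast v (m i),
      sub_eq_add_neg, Real.rpow_add hv, Real.rpow_add hv]
    ring
  have huc : ∀ i, ¬ (∀ᶠ v in 𝓝 0, φ i v = 0) → Tendsto (u i) (𝓝[>] 0) (𝓝 (u i 0)) :=
    fun i hi => (hu i hi).continuousAt.tendsto.mono_left nhdsWithin_le_nhds
  have lim : ∀ i ∈ Finset.range I, Tendsto (fun v : ℝ => v ^ (-E) * ((v ^ α) ^ i * φ i v)) (𝓝[>] 0)
      (𝓝 (if i = j then u j 0 else 0)) := by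
    intro i hiI
    by_cases hij : i = j
    · subst hij
      rw [if_pos rfl]
      refine (huc i hjS'.2).congr' ?_
      filter_upwards [term i hjS'.2] with v hv
      rw [hv, hE, sub_self, Real.rpow_zero, one_mul]
    · rw [if_neg hij]
      by_cases hzero : ∀ᶠ v in 𝓝 0, φ i v = 0
      · refine tendsto_const_nhds.congr' ?_
        filter_upwards [nhdsWithin_le_nhds hzero] with v hv
        simp [hv]
      · have hle := hj i (Finset.mem_filter.2 ⟨hiI, hzero⟩)
        have hne : α * i + m i ≠ E := by
          intro heq
          rw [hE] at heq
          apply hirr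
          have hij' : (i : ℝ) - j ≠ 0 := by
            rw [sub_ne_zero]; exact_mod_cast hij
          refine ⟨((m j : ℚ) - m i) / (i - j), ?_⟩
          push_cast
          rw [div_eq_iff hij']
          linarith
        have hlt : 0 < α * i + m i - E := sub_pos.2 (lt_of_le_of_ne hle (Ne.symm hne))
        have := (tend0 _ hlt).mul (huc i hzero)
        rw [zero_mul] at this
        exact this.congr' (term i hzero).symm
  have limsum := tendsto_finsetSum (Finset.range I) lim
  rw [Finset.sum_ite_eq' , if_pos hjS'.1] at limsum
  -- tail
  have tail : Tendsto (fun v : ℝ => v ^ (-E) * (Φ v - ∑ i ∈ Finset.range I, (v ^ α) ^ i * φ i v))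
      (𝓝[>] 0) (𝓝 0) := by
    have h1 := (Asymptotics.isBigO_refl (fun v : ℝ => v ^ (-E)) (𝓝[>] 0)).mul (hΦ I)
    refine h1.trans_tendsto ?_
    refine (tend0 (α * I - E) (by linarith)).congr' ?_
    filter_upwards [hpos] with v hv
    rw [← Real.rpow_natCast (v ^ α) I, ← Real.rpow_mul hv.le, ← Real.rpow_add hv]
    ring_nf
  have tot := tail.add limsum
  rw [zero_add] at tot
  have hne := tot.eventually_ne (hu0 j hjS'.2)
  obtain ⟨v, hv1, hv2⟩ := (hz.and_eventually hne).exists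
  apply hv2
  rw [← Finset.mul_sum, hv1]
  ring

lemma irr_case (c θ : ℝ) (hc : c ≠ 0) (hθ0 : θ ≠ 0) (hθ : θ < 1) (hirr : Irrational (1 - θ))
    (d N : ℕ) (p : ℕ → ℝ[X]) (hp : p 0 ≠ 0)
    (h : ∀ n : ℕ, N ≤ n → ∑ k ∈ Finset.range (d + 1),
      (p k).eval (n : ℝ) * Real.exp (c * ((n + k : ℕ) : ℝ) ^ θ) = 0) : False := by
  obtain ⟨D, P, hP, hsum⟩ := transform c θ d p
  set Φ : ℝ → ℝ := fun v => ∑ k ∈ Finset.range (d + 1), (P k).eval v * Real.exp (c * (v ^ (1 - θ) * gfun θ k v)) with hΦdef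
  have hα : 0 < 1 - θ := by linarith
  have tend0 : Tendsto (fun v : ℝ => v ^ (1 - θ)) (𝓝[>] 0) (𝓝 0) := by
    have h := (Real.continuousAt_rpow_const 0 (1 - θ) (Or.inr hα.le)).tendsto
    rw [Real.zero_rpow hα.ne'] at h
    exact h.mono_left nhdsWithin_le_nhds
  have gc : ∀ k, Tendsto (gfun θ k) (𝓝[>] 0) (𝓝 (gfun θ k 0)) := fun k =>
    (gfun_analytic θ k).continuousAt.tendsto.mono_left nhdsWithin_le_nhds
  have Pc : ∀ k, Tendsto (fun v => (P k).eval v) (𝓝[>] 0) (𝓝 ((P k).eval 0)) := fun k =>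
    (P k).continuous.continuousAt.tendsto.mono_left nhdsWithin_le_nhds
  set φ : ℕ → ℝ → ℝ := fun i v => ∑ k ∈ Finset.range (d + 1), (P k).eval v * ((c * gfun θ k v) ^ i / i.factorial) with hφdef
  have hφ : ∀ i, AnalyticAt ℝ (φ i) 0 := by
    intro i
    refine Finset.analyticAt_fun_sum _ fun k _ => ?_
    have h1 := gfun_analytic θ k
    have h2 := poly_analytic (P k) 0
    fun_prop
  have hΦ : ∀ I : ℕ, (fun v => Φ v - ∑ i ∈ Finset.range I, (v ^ (1 - θ)) ^ i * φ i v)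
      =O[𝓝[>] 0] fun v => (v ^ (1 - θ)) ^ I := by
    intro I
    have heq : (fun v => Φ v - ∑ i ∈ Finset.range I, (v ^ (1 - θ)) ^ i * φ i v) = fun v =>
        ∑ k ∈ Finset.range (d + 1), (P k).eval v * (Real.exp (c * (v ^ (1 - θ) * gfun θ k v)) -
          ∑ i ∈ Finset.range I, (c * (v ^ (1 - θ) * gfun θ k v)) ^ i / i.factorial) := by
      funext v
      simp only [hΦdef, hφdef, mul_sub, Finset.sum_sub_distrib, Finset.mul_sum]
      congr 1
      rw [Finset.sum_comm]
      refine Finset.sum_congr rfl fun k _ => Finset.sum_congr rfl fun i _ => ?_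
      ring
    rw [heq]
    refine Asymptotics.IsBigO.fun_sum fun k _ => ?_
    have ht : Tendsto (fun v => c * (v ^ (1 - θ) * gfun θ k v)) (𝓝[>] 0) (𝓝 0) := by
      simpa using (tend0.mul (gc k)).const_mul c
    have h1 := (Real.exp_sub_sum_range_isBigO_pow I).comp_tendsto ht
    have h2 : (fun v => c * (v ^ (1 - θ) * gfun θ k v)) =O[𝓝[>] 0] fun v => v ^ (1 - θ) := by
      have := ((Asymptotics.isBigO_refl (fun v : ℝ => v ^ (1 - θ)) (𝓝[>] 0)).mul
        ((gc k).isBigO_one (F := ℝ))).const_mul_left c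
      simpa using this
    have h3 := ((Pc k).isBigO_one (F := ℝ)).mul (h1.trans (h2.pow I))
    simpa [Function.comp_def] using h3
  have hz : ∃ᶠ v in 𝓝[>] (0 : ℝ), Φ v = 0 := by
    have ht : Tendsto (fun n : ℕ => ((n : ℝ))⁻¹) atTop (𝓝[>] 0) :=
      tendsto_inv_atTop_nhdsGT_zero.comp tendsto_natCast_atTop_atTop
    refine ht.frequently (Eventually.frequently ?_)
    filter_upwards [eventually_ge_atTop N, eventually_gt_atTop 0] with n hn hn0
    have hn0' : (0 : ℝ) < n := by exact_mod_cast hn0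
    have h1 := hsum (n : ℝ)⁻¹ (by positivity)
    have h2 := h n hn
    simp only [inv_inv] at h1
    push_cast at h2
    rw [h2, mul_zero] at h1
    exact h1
  have hall := dominance (1 - θ) hα hirr φ hφ Φ hΦ hz
  have hev : ∀ᶠ v in 𝓝[>] (0 : ℝ), ∀ i ∈ Finset.range (d + 1), φ i v = 0 := by
    rw [Filter.eventually_all_finset]
    exact fun i _ => nhdsWithin_le_nhds (hall i)
  have hzero : ∀ᶠ v in 𝓝[>] (0 : ℝ), (p 0).eval v⁻¹ = 0 := by
    filter_upwards [hev, self_mem_nhdsWithin] with v hv hv0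
    have hv0 : 0 < v := hv0
    have hinj : Function.Injective fun k : Fin (d + 1) => c * gfun θ k v := by
      intro a b hab
      have h1 : gfun θ a v = gfun θ b v := mul_left_cancel₀ hc hab
      have h2 := gfun_spec θ a v
      rw [h1, gfun_spec θ b v] at h2
      have h3 : (1 + (b : ℕ) * v) ^ θ = (1 + (a : ℕ) * v) ^ θ := by linarith
      have h4 := (Real.rpow_left_inj (by positivity) (by positivity) hθ0).1 h3
      have h5 : ((b : ℕ) : ℝ) = ((a : ℕ) : ℝ) := by
        have : ((b : ℕ) : ℝ) * v = ((a : ℕ) : ℝ) * v := by linarith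
        exact mul_right_cancel₀ hv0.ne' this
      exact (Fin.ext (by exact_mod_cast h5)).symm
    have hvm := Matrix.eq_zero_of_forall_pow_sum_mul_pow_eq_zero (v := fun k : Fin (d + 1) => (P k).eval v)
      hinj (by
        intro i
        have h1 := hv i (Finset.mem_range.2 i.2)
        simp only [hφdef] at h1
        rw [← Finset.sum_range fun k => (P k).eval v * (c * gfun θ k v) ^ (i : ℕ)]
        simp only [← mul_div_assoc] at h1
        rw [← Finset.sum_div] at h1
        simpa [Nat.factorial_ne_zero] using h1)
    have h0 := congrFun hvm 0
    simp only [Pi.zero_apply, Fin.val_zero] at h0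
    rw [hP 0 (by simp) v hv0] at h0
    have : v ^ D ≠ 0 := by positivity
    simpa [this] using h0
  have hat : ∀ᶠ x in (atTop : Filter ℝ), (p 0).eval x = 0 := by
    have := tendsto_inv_atTop_nhdsGT_zero.eventually hzero
    simpa using this
  obtain ⟨δ, hδ, hl⟩ := poly_lower _ hp
  obtain ⟨x, h1, h2⟩ := (hat.and hl).exists
  rw [h1, abs_zero] at h2
  linarith

lemma rat_zero (c θ : ℝ) (a b : ℕ) (hb : 0 < b) (hab : 1 - θ = a / b)
    (d N : ℕ) (p : ℕ → ℝ[X])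
    (h : ∀ n : ℕ, N ≤ n → ∑ k ∈ Finset.range (d + 1),
      (p k).eval (n : ℝ) * Real.exp (c * ((n + k : ℕ) : ℝ) ^ θ) = 0) :
    ∀ᶠ x : ℝ in atTop, ∑ k ∈ Finset.range (d + 1), (p k).eval x * Real.exp (c * (x + k) ^ θ) = 0 := by
  obtain ⟨D, P, hP, hsum⟩ := transform c θ d p
  have hbR : (0 : ℝ) < b := by exact_mod_cast hb
  set M : ℝ → ℝ := fun t => ∑ k ∈ Finset.range (d + 1),
    (P k).eval (t ^ b) * Real.exp (c * (t ^ a * gfun θ k (t ^ b))) with hM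
  have hMan : AnalyticAt ℝ M 0 := by
    refine Finset.analyticAt_fun_sum _ fun k _ => ?_
    have h0 : AnalyticAt ℝ (fun t : ℝ => t ^ b) 0 := by fun_prop
    have h1 : AnalyticAt ℝ (fun t : ℝ => gfun θ k (t ^ b)) 0 :=
      AnalyticAt.fun_comp (by simpa [hb.ne'] using gfun_analytic θ k) h0
    have h2 : AnalyticAt ℝ (fun t : ℝ => (P k).eval (t ^ b)) 0 :=
      AnalyticAt.fun_comp (poly_analytic (P k) _) h0
    fun_prop
  have hMv : ∀ v : ℝ, 0 < v → M (v ^ (1 / b : ℝ)) = v ^ D * Real.exp (-(c * (v⁻¹) ^ θ)) *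
        ∑ k ∈ Finset.range (d + 1), (p k).eval v⁻¹ * Real.exp (c * (v⁻¹ + k) ^ θ) := by
    intro v hv
    rw [← hsum v hv, hM]
    have e1 : (v ^ (1 / b : ℝ)) ^ b = v := by
      rw [← Real.rpow_natCast, ← Real.rpow_mul hv.le, one_div, inv_mul_cancel₀ hbR.ne', Real.rpow_one]
    have e2 : (v ^ (1 / b : ℝ)) ^ a = v ^ (1 - θ) := by
      rw [← Real.rpow_natCast, ← Real.rpow_mul hv.le, hab]
      congr 1; ring
    simp only [e1, e2]
  have ht : Tendsto (fun v : ℝ => v ^ (1 / b : ℝ)) (𝓝[>] 0) (𝓝[>] 0) := by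
    have hp : (0 : ℝ) < 1 / b := by positivity
    refine tendsto_nhdsWithin_iff.2 ⟨?_, ?_⟩
    · have h := (Real.continuousAt_rpow_const 0 (1 / b : ℝ) (Or.inr hp.le)).tendsto
      rw [Real.zero_rpow hp.ne'] at h
      exact h.mono_left nhdsWithin_le_nhds
    · filter_upwards [self_mem_nhdsWithin] with v hv
      exact Real.rpow_pos_of_pos hv _
  have hz : ∃ᶠ t in 𝓝[≠] (0 : ℝ), M t = 0 := by
    have ht2 : Tendsto (fun n : ℕ => (((n : ℝ))⁻¹) ^ (1 / b : ℝ)) atTop (𝓝[≠] 0) :=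
      (ht.comp (tendsto_inv_atTop_nhdsGT_zero.comp tendsto_natCast_atTop_atTop)).mono_right
        (nhdsWithin_mono _ fun x hx => ne_of_gt hx)
    refine ht2.frequently (Eventually.frequently ?_)
    filter_upwards [eventually_ge_atTop N, eventually_gt_atTop 0] with n hn hn0
    have hn0' : (0 : ℝ) < n := by exact_mod_cast hn0
    have h1 := hMv (n : ℝ)⁻¹ (by positivity)
    have h2 := h n hn
    simp only [inv_inv] at h1
    push_cast at h2
    rw [h2, mul_zero] at h1
    exact h1
  have hev := hMan.frequently_zero_iff_eventually_zero.1 hz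
  have hev2 : ∀ᶠ v in 𝓝[>] (0 : ℝ), M (v ^ (1 / b : ℝ)) = 0 :=
    ht.eventually (nhdsWithin_le_nhds hev)
  have hat := tendsto_inv_atTop_nhdsGT_zero.eventually hev2
  filter_upwards [hat, eventually_gt_atTop 0] with x hx hx0
  rw [hMv _ (by positivity)] at hx
  simp only [inv_inv] at hx
  have hne : (x⁻¹) ^ D * Real.exp (-(c * x ^ θ)) ≠ 0 := by positivity
  exact (mul_eq_zero.1 hx).resolve_left hne

lemma poly_not_ev_zero (p : ℝ[X]) (hp : p ≠ 0) : ¬ ∀ᶠ x in 𝓝 (0 : ℝ), p.eval x = 0 := by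
  intro h
  have hfr : ∃ᶠ x in 𝓝[≠] (0 : ℝ), p.eval x = 0 := (h.filter_mono nhdsWithin_le_nhds).frequently
  apply hp
  refine eq_zero_of_infinite_isRoot p ?_
  intro hfin
  have h2 : ∀ᶠ x in 𝓝[≠] (0 : ℝ), p.eval x ≠ 0 := by
    have hc : ({x | p.IsRoot x} \ {0})ᶜ ∈ 𝓝 (0 : ℝ) :=
      (hfin.subset Set.sdiff_subset).isClosed.isOpen_compl.mem_nhds (by simp)
    filter_upwards [nhdsWithin_le_nhds hc, self_mem_nhdsWithin] with x hx hx0 hx2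
    exact hx ⟨hx2, hx0⟩
  obtain ⟨x, h3, h4⟩ := (hfr.and_eventually h2).exists
  exact h4 h3

lemma ev_zero_of_right (A : ℝ → ℝ) (hA : AnalyticAt ℝ A 0) (h : ∀ᶠ x in 𝓝[>] (0 : ℝ), A x = 0) :
    ∀ᶠ x in 𝓝 (0 : ℝ), A x = 0 :=
  hA.frequently_zero_iff_eventually_zero.1
    (h.frequently.filter_mono (nhdsWithin_mono _ fun _ hx => ne_of_gt hx))

lemma flat (γ θ : ℝ) (hγ : 0 < γ) (hθ : θ < 0) (A B : ℝ → ℝ) (hA : AnalyticAt ℝ A 0)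
    (hB : AnalyticAt ℝ B 0)
    (h : ∀ᶠ x in 𝓝[>] (0 : ℝ), A x = Real.exp (-γ * x ^ θ) * B x) : ∀ᶠ x in 𝓝 (0 : ℝ), A x = 0 := by
  by_contra hne
  obtain ⟨m, u, hu, hu0, hmu⟩ := hA.exists_eventuallyEq_pow_smul_nonzero_iff.2 hne
  have h1 : Tendsto (fun x : ℝ => (x⁻¹) ^ m * Real.exp (-γ * x ^ θ)) (𝓝[>] 0) (𝓝 0) := by
    have h2 := (poly_mul_exp_tendsto (X ^ m) γ (-θ) hγ (by linarith)).comp tendsto_inv_nhdsGT_zero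
    refine h2.congr' ?_
    filter_upwards [self_mem_nhdsWithin] with x hx
    have hx : 0 < x := hx
    simp only [Function.comp, eval_pow, eval_X]
    rw [abs_of_pos (by positivity), Real.inv_rpow hx.le, Real.rpow_neg hx.le, inv_inv]
  have hBc : Tendsto B (𝓝[>] 0) (𝓝 (B 0)) := hB.continuousAt.tendsto.mono_left nhdsWithin_le_nhds
  have huc : Tendsto u (𝓝[>] 0) (𝓝 (u 0)) := hu.continuousAt.tendsto.mono_left nhdsWithin_le_nhds
  have h3 := h1.mul hBc
  rw [zero_mul] at h3
  refine hu0 (tendsto_nhds_unique huc (h3.congr' ?_))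
  filter_upwards [h, nhdsWithin_le_nhds hmu, self_mem_nhdsWithin] with x h4 h5 hx
  have hx : 0 < x := hx
  rw [mul_assoc, ← h4, h5, sub_zero, smul_eq_mul, inv_pow, inv_mul_cancel_left₀ (by positivity)]

lemma cusp (c θ : ℝ) (hc : c ≠ 0) (hθ0 : 0 < θ) (hθ : θ < 1) (A B : ℝ → ℝ) (hA : AnalyticAt ℝ A 0)
    (hB : AnalyticAt ℝ B 0) (hAne : ¬ ∀ᶠ x in 𝓝 (0 : ℝ), A x = 0)
    (h : ∀ᶠ x in 𝓝[>] (0 : ℝ), A x * Real.exp (c * x ^ θ) = B x) : False := by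
  have hBne : ¬ ∀ᶠ x in 𝓝 (0 : ℝ), B x = 0 := by
    intro hB0
    apply hAne
    apply ev_zero_of_right A hA
    filter_upwards [h, nhdsWithin_le_nhds hB0] with x h1 h2
    rw [h2] at h1
    exact (mul_eq_zero.1 h1).resolve_right (Real.exp_ne_zero _)
  obtain ⟨m, u, hu, hu0, hmu⟩ := hA.exists_eventuallyEq_pow_smul_nonzero_iff.2 hAne
  obtain ⟨l, s, hs, hs0, hls⟩ := hB.exists_eventuallyEq_pow_smul_nonzero_iff.2 hBne
  have huc : Tendsto u (𝓝[>] 0) (𝓝 (u 0)) := hu.continuousAt.tendsto.mono_left nhdsWithin_le_nhds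
  have hsc : Tendsto s (𝓝[>] 0) (𝓝 (s 0)) := hs.continuousAt.tendsto.mono_left nhdsWithin_le_nhds
  have tend0 : ∀ β : ℝ, 0 < β → Tendsto (fun v : ℝ => v ^ β) (𝓝[>] 0) (𝓝 0) := by
    intro β hβ
    have h := (Real.continuousAt_rpow_const 0 β (Or.inr hβ.le)).tendsto
    rw [Real.zero_rpow hβ.ne'] at h
    exact h.mono_left nhdsWithin_le_nhds
  have tpow : ∀ n : ℕ, n ≠ 0 → Tendsto (fun v : ℝ => v ^ n) (𝓝[>] 0) (𝓝 0) := by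
    intro n hn
    have := (continuous_pow n (M := ℝ)).tendsto 0
    simp only [zero_pow hn] at this
    exact this.mono_left nhdsWithin_le_nhds
  have hE : Tendsto (fun x : ℝ => Real.exp (c * x ^ θ)) (𝓝[>] 0) (𝓝 1) := by
    have := ((tend0 θ hθ0).const_mul c).rexp
    simpa using this
  have huE := huc.mul hE
  rw [mul_one] at huE
  have h' : ∀ᶠ x in 𝓝[>] (0 : ℝ), 0 < x ∧ x ^ m * (u x * Real.exp (c * x ^ θ)) = x ^ l * s x := by
    filter_upwards [h, nhdsWithin_le_nhds hmu, nhdsWithin_le_nhds hls, self_mem_nhdsWithin] with x h1 h2 h3 hx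
    rw [h2, h3] at h1
    simp only [sub_zero, smul_eq_mul] at h1
    exact ⟨hx, by linarith⟩
  rcases lt_trichotomy m l with hlt | rfl | hlt
  · obtain ⟨r, rfl⟩ := Nat.exists_eq_add_of_lt hlt
    have h1 := (tpow (r + 1) (by omega)).mul hsc
    rw [zero_mul] at h1
    refine hu0 (tendsto_nhds_unique huE (h1.congr' ?_))
    filter_upwards [h'] with x hx
    have hxm : x ^ m ≠ 0 := pow_ne_zero _ hx.1.ne'
    apply mul_left_cancel₀ hxm
    rw [hx.2]; ring
  · have heq : ∀ᶠ x in 𝓝[>] (0 : ℝ), u x * Real.exp (c * x ^ θ) = s x := by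
      filter_upwards [h'] with x hx
      exact mul_left_cancel₀ (pow_ne_zero _ hx.1.ne') hx.2
    have hus : u 0 = s 0 := tendsto_nhds_unique huE (hsc.congr' (by
      filter_upwards [heq] with x hx using hx.symm))
    have hO : (fun x => s x - u x) =O[𝓝[>] 0] fun x => x := by
      have h1 := ((hs.sub hu).differentiableAt.isBigO_sub).mono (nhdsWithin_le_nhds (s := Set.Ioi 0))
      simpa [hus] using h1
    have hlim0 : Tendsto (fun x : ℝ => x ^ (-θ) * (s x - u x)) (𝓝[>] 0) (𝓝 0) := by
      refine ((Asymptotics.isBigO_refl (fun x : ℝ => x ^ (-θ)) (𝓝[>] 0)).mul hO).trans_tendsto ?_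
      refine (tend0 (1 - θ) (by linarith)).congr' ?_
      filter_upwards [self_mem_nhdsWithin] with x hx
      have hx : 0 < x := hx
      rw [← Real.rpow_add_one hx.ne']; ring_nf
    have hder : HasDerivAt (fun y : ℝ => Real.exp (c * y)) c 0 := by
      have := ((hasDerivAt_id (0 : ℝ)).const_mul c).exp
      simpa using this
    have hsl := hasDerivAt_iff_tendsto_slope.1 hder
    have htt : Tendsto (fun x : ℝ => x ^ θ) (𝓝[>] 0) (𝓝[≠] 0) := by
      refine tendsto_nhdsWithin_iff.2 ⟨tend0 θ hθ0, ?_⟩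
      filter_upwards [self_mem_nhdsWithin] with x hx
      exact (Real.rpow_pos_of_pos hx θ).ne'
    have hcu := huc.mul (hsl.comp htt)
    have hfin : u 0 * c = 0 := by
      refine tendsto_nhds_unique hcu (hlim0.congr' ?_)
      filter_upwards [heq, self_mem_nhdsWithin] with x hx hx0
      have hx0 : 0 < x := hx0
      simp only [Function.comp, slope_def_field, mul_zero, Real.exp_zero, sub_zero]
      rw [← hx, Real.rpow_neg hx0.le]
      ring
    exact (mul_ne_zero hu0 hc) hfin
  · obtain ⟨r, rfl⟩ := Nat.exists_eq_add_of_lt hlt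
    have h1 := (tpow (r + 1) (by omega)).mul huE
    rw [zero_mul] at h1
    refine hs0 (tendsto_nhds_unique hsc (h1.congr' ?_))
    filter_upwards [h'] with x hx
    have hxm : x ^ l ≠ 0 := pow_ne_zero _ hx.1.ne'
    apply mul_left_cancel₀ hxm
    rw [← hx.2]; ring

lemma singular (c θ : ℝ) (hc : c ≠ 0) (hθ0 : θ ≠ 0) (hθ : θ < 1) (d : ℕ) (p : ℕ → ℝ[X]) (hp : p 0 ≠ 0)
    (h : ∀ᶠ x : ℝ in atTop, ∑ k ∈ Finset.range (d + 1), (p k).eval x * Real.exp (c * (x + k) ^ θ) = 0) :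
    False := by
  have term_an : ∀ (k : ℕ) (x : ℝ), 0 < x + k →
      AnalyticAt ℝ (fun x : ℝ => (p k).eval x * Real.exp (c * (x + k) ^ θ)) x := by
    intro k x hx
    have h1 := poly_analytic (p k) x
    have h2 := rpow_analytic θ (fun v => v + k) x (by fun_prop) hx
    fun_prop
  have hF : AnalyticOnNhd ℝ (fun x : ℝ => ∑ k ∈ Finset.range (d + 1), (p k).eval x * Real.exp (c * (x + k) ^ θ))
      (Set.Ioi 0) := by
    intro x hx
    have hx : 0 < x := hx
    exact Finset.analyticAt_fun_sum _ fun k _ => term_an k x (by positivity)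
  obtain ⟨x1, hx1⟩ := eventually_atTop.1 h
  obtain ⟨x0, hx0, hx0'⟩ : ∃ x0 : ℝ, (∀ x, x0 ≤ x →
      ∑ k ∈ Finset.range (d + 1), (p k).eval x * Real.exp (c * (x + k) ^ θ) = 0) ∧ 0 < x0 :=
    ⟨max x1 1, fun x hx => hx1 x ((le_max_left _ _).trans hx), by positivity⟩
  have hzero := hF.eqOn_zero_of_preconnected_of_eventuallyEq_zero isPreconnected_Ioi
    (z₀ := x0 + 1) (show (0 : ℝ) < x0 + 1 by linarith) (by
      filter_upwards [lt_mem_nhds (show x0 < x0 + 1 by linarith)] with x hx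
      exact hx0 x hx.le)
  set H : ℝ → ℝ := fun x => -∑ k ∈ Finset.range d, (p (k + 1)).eval x * Real.exp (c * (x + (k + 1 : ℕ)) ^ θ) with hH
  have hHan : AnalyticAt ℝ H 0 :=
    (Finset.analyticAt_fun_sum _ fun k _ => term_an (k + 1) 0 (by positivity)).neg
  have hrel : ∀ x : ℝ, 0 < x → (p 0).eval x * Real.exp (c * x ^ θ) = H x := by
    intro x hx
    have h1 := hzero (show x ∈ Set.Ioi 0 from hx)
    simp only [Pi.zero_apply] at h1
    rw [Finset.sum_range_succ'] at h1
    simp only [Nat.cast_zero, add_zero] at h1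
    rw [hH]; linarith
  have hp0 := poly_not_ev_zero _ hp
  have hp0an := poly_analytic (p 0) 0
  rcases lt_or_gt_of_ne hθ0 with hneg | hpos
  · rcases lt_or_gt_of_ne hc with hcneg | hcpos
    · have h1 := flat (-c) θ (by linarith) hneg H _ hHan hp0an (by
        filter_upwards [self_mem_nhdsWithin] with x hx
        rw [← hrel x hx, neg_neg, mul_comm])
      apply hp0
      apply ev_zero_of_right _ hp0an
      filter_upwards [nhdsWithin_le_nhds h1, self_mem_nhdsWithin] with x h2 hx
      have h3 := hrel x hx
      rw [h2] at h3
      exact (mul_eq_zero.1 h3).resolve_right (Real.exp_ne_zero _)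
    · refine hp0 (flat c θ hcpos hneg _ H hp0an hHan ?_)
      filter_upwards [self_mem_nhdsWithin] with x hx
      rw [← hrel x hx, neg_mul, Real.exp_neg]
      field_simp
  · refine cusp c θ hc hpos hθ _ H hp0an hHan hp0 ?_
    filter_upwards [self_mem_nhdsWithin] with x hx
    exact hrel x hx

lemma main_aux (c θ : ℝ) (hc : c ≠ 0) (hθ0 : θ ≠ 0) (hθ1 : θ ≠ 1) (f : ℕ → ℂ)
    (hf : ∀ n : ℕ, 1 ≤ n → f n = (Real.exp (c * (n : ℝ) ^ θ) : ℂ)) : ¬ IsHolonomic f := by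
  intro hol
  obtain ⟨d, N, p, hp, h⟩ := real_rec f (fun n => Real.exp (c * (n : ℝ) ^ θ)) (by
    intro n hn; rw [hf n hn]) hol
  rcases lt_or_gt_of_ne hθ1 with hlt | hgt
  · by_cases hirr : Irrational (1 - θ)
    · exact irr_case c θ hc hθ0 hlt hirr d N p hp h
    · unfold Irrational at hirr
      push Not at hirr
      obtain ⟨q, hq⟩ := hirr
      have hq0 : 0 < q := by
        have : (0 : ℝ) < q := by rw [hq]; linarith
        exact_mod_cast this
      refine singular c θ hc hθ0 hlt d p hp (rat_zero c θ q.num.toNat q.den q.den_pos ?_ d N p h)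
      rw [← hq]
      have h1 : ((q.num.toNat : ℤ)) = q.num := Int.toNat_of_nonneg (Rat.num_nonneg.2 hq0.le)
      have h2 : ((q.num.toNat : ℕ) : ℝ) = (q.num : ℝ) := by exact_mod_cast h1
      rw [h2]
      exact Rat.cast_def q
  · exact big_theta c θ hc hgt d N p hp h

/-- The sequences `e^{c n^θ}`, with `c, θ ∈ ℝ`, are non-holonomic, except in the trivial
cases `c = 0` or `θ ∈ {0, 1}`.  In particular, `e^{√n}`, `e^{-√n}`, `e^{1/n}`, `e^{-1/n}`
are non-holonomic. -/
theorem exp_pow_not_holonomic (c θ : ℝ) (hc : c ≠ 0) (hθ0 : θ ≠ 0) (hθ1 : θ ≠ 1) :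
    (∀ f : ℕ → ℂ, (∀ n : ℕ, 1 ≤ n → f n = (Real.exp (c * (n : ℝ) ^ θ) : ℂ)) →
        ¬ IsHolonomic f) ∧
    (∀ f : ℕ → ℂ, (∀ n : ℕ, 1 ≤ n → f n = (Real.exp (Real.sqrt (n : ℝ)) : ℂ)) →
        ¬ IsHolonomic f) ∧
    (∀ f : ℕ → ℂ, (∀ n : ℕ, 1 ≤ n → f n = (Real.exp (-Real.sqrt (n : ℝ)) : ℂ)) →
        ¬ IsHolonomic f) ∧
    (∀ f : ℕ → ℂ, (∀ n : ℕ, 1 ≤ n → f n = (Real.exp (1 / (n : ℝ)) : ℂ)) →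
        ¬ IsHolonomic f) ∧
    (∀ f : ℕ → ℂ, (∀ n : ℕ, 1 ≤ n → f n = (Real.exp (-(1 / (n : ℝ))) : ℂ)) →
        ¬ IsHolonomic f) := by
  refine ⟨fun f hf => main_aux c θ hc hθ0 hθ1 f hf, fun f hf => ?_, fun f hf => ?_, fun f hf => ?_,
    fun f hf => ?_⟩
  · refine main_aux 1 (1 / 2) one_ne_zero (by norm_num) (by norm_num) f fun n hn => ?_
    rw [hf n hn, Real.sqrt_eq_rpow, one_mul]
  · refine main_aux (-1) (1 / 2) (by norm_num) (by norm_num) (by norm_num) f fun n hn => ?_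
    rw [hf n hn, Real.sqrt_eq_rpow, neg_one_mul]
  · refine main_aux 1 (-1) one_ne_zero (by norm_num) (by norm_num) f fun n hn => ?_
    rw [hf n hn, Real.rpow_neg_one, one_mul, one_div]
  · refine main_aux (-1) (-1) (by norm_num) (by norm_num) (by norm_num) f fun n hn => ?_
    rw [hf n hn, Real.rpow_neg_one, neg_one_mul, one_div]
end

section
/- Every sequence f : ℕ → ℂ satisfying f(n) = Γ(n·i) for all n ≥ 1, where Γ is the complex Gamma function and i = √(−1), is not holonomic. -/
open Filter Topology Complex

/-- `log (w+1) - log w = log (1+1/w)` on the closed right half plane. -/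
lemma log_succ_aux (w : ℂ) (hw : w ≠ 0) (hre : 0 ≤ w.re) :
    Complex.log (w + 1) = Complex.log w + Complex.log (1 + 1 / w) := by
  have hre2 : 0 < (1 + 1 / w).re := by
    have : 0 ≤ (1 / w).re := by
      rw [one_div, Complex.inv_re]; exact div_nonneg hre (Complex.normSq_nonneg w)
    simp only [Complex.add_re, Complex.one_re]; linarith
  have h2 : (1 + 1 / w) ≠ 0 := by
    intro h; rw [h] at hre2; simp at hre2
  have e : w + 1 = w * (1 + 1 / w) := by field_simp
  rw [e, Complex.log_mul hw h2]
  have a1 := Complex.abs_arg_le_pi_div_two_iff.mpr hre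
  have a2 : |(1 + 1 / w).arg| < Real.pi / 2 := Complex.abs_arg_lt_pi_div_two_iff.mpr (Or.inl hre2)
  rw [abs_le] at a1
  rw [abs_lt] at a2
  constructor <;> linarith [a1.1, a1.2, a2.1, a2.2]

lemma log_est_aux (t w : ℂ) (hw : 2 ≤ ‖w‖) (hw2 : 2 * ‖t‖ ≤ ‖w‖) :
    ‖Complex.log (1 + t / w) - t * Complex.log (1 + 1 / w)‖ ≤ (‖t‖ ^ 2 + ‖t‖) / ‖w‖ ^ 2 := by
  have key : ∀ z : ℂ, ‖z‖ ≤ 1 / 2 → ‖Complex.log (1 + z) - z‖ ≤ ‖z‖ ^ 2 := by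
    intro z hz
    have h := Complex.norm_log_one_add_sub_self_le (z := z) (by linarith)
    refine h.trans ?_
    have : (1 - ‖z‖)⁻¹ ≤ 2 := by
      rw [inv_le_comm₀ (by linarith) (by norm_num)]; linarith
    nlinarith [sq_nonneg ‖z‖]
  have hpos : 0 < ‖w‖ := by linarith
  have h1 := key (t / w) (by rw [norm_div, div_le_iff₀ hpos]; linarith)
  have h2 := key (1 / w) (by rw [norm_div, div_le_iff₀ hpos, norm_one]; linarith)
  have e : Complex.log (1 + t / w) - t * Complex.log (1 + 1 / w)
      = (Complex.log (1 + t / w) - t / w) - t * (Complex.log (1 + 1 / w) - 1 / w) := by ring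
  rw [e]
  refine (norm_sub_le _ _).trans ?_
  rw [norm_mul]
  rw [norm_div] at h1 h2
  have h3 := mul_le_mul_of_nonneg_left h2 (norm_nonneg t)
  refine (add_le_add h1 h3).trans (le_of_eq ?_)
  rw [norm_one]; field_simp

lemma sum_est_aux (n : ℝ) (hn : 2 ≤ n) (N : ℕ) :
    ∑ j ∈ Finset.range N, 1 / (n ^ 2 + (j : ℝ) ^ 2) ≤ 2 / (n - 1) := by
  have : ∑ j ∈ Finset.range N, 1 / (n ^ 2 + (j : ℝ) ^ 2) ≤ 2 / (n - 1) - 2 / (n - 1 + N) := by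
    induction N with
    | zero => simp
    | succ N ih =>
      rw [Finset.sum_range_succ]
      have hN : (0 : ℝ) ≤ N := Nat.cast_nonneg N
      have : 1 / (n ^ 2 + (N : ℝ) ^ 2) ≤ 2 / (n - 1 + N) - 2 / (n - 1 + (N + 1 : ℕ)) := by
        push_cast
        have h1 : 0 < n - 1 + N := by linarith
        have h2 : 0 < n - 1 + (N + 1) := by linarith
        rw [div_sub_div _ _ h1.ne' h2.ne', div_le_div_iff₀ (by positivity) (by positivity)]
        nlinarith [sq_nonneg (n - N)]
      linarith
  have h : 0 ≤ 2 / (n - 1 + N) := by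
    have : (0 : ℝ) ≤ N := Nat.cast_nonneg N
    apply div_nonneg <;> linarith
  linarith

lemma tail_aux (s t : ℂ) :
    Tendsto (fun N : ℕ => (N : ℂ) ^ t * Complex.exp (-(t * Complex.log (s + (N + 1 : ℕ)))))
      atTop (𝓝 1) := by
  have hz : Tendsto (fun N : ℕ => 1 + (s + 1) / (N : ℂ)) atTop (𝓝 (1 + 0)) := by
    exact tendsto_const_nhds.add (tendsto_const_div_atTop_nhds_zero_nat (s + 1))
  rw [add_zero] at hz
  have hl : Tendsto (fun N : ℕ => Complex.exp (-(t * Complex.log (1 + (s + 1) / (N : ℂ)))))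
      atTop (𝓝 (Complex.exp (-(t * Complex.log 1)))) := by
    have := (hz.clog (by simp)).const_mul t
    exact (Complex.continuous_exp.tendsto _).comp this.neg
  simp only [Complex.log_one, mul_zero, neg_zero, Complex.exp_zero] at hl
  refine hl.congr' ?_
  filter_upwards [eventually_gt_atTop 0, hz.eventually_ne one_ne_zero] with N hN hne
  have hN0 : (N : ℂ) ≠ 0 := by exact_mod_cast hN.ne'
  have e : s + ((N + 1 : ℕ) : ℂ) = ((N : ℝ) : ℂ) * (1 + (s + 1) / (N : ℂ)) := by
    push_cast; field_simp; ring
  rw [e, Complex.log_ofReal_mul (by exact_mod_cast hN) hne, Complex.cpow_def_of_ne_zero hN0,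
    ← Complex.exp_add, ← Complex.natCast_log]
  congr 1
  push_cast
  ring

lemma gamma_ratio_bound (t : ℂ) (n : ℝ) (hn : 2 ≤ n) (hnt : 2 * ‖t‖ ≤ n) (ht : t.re = 0) (hti : 0 ≤ t.im) :
    ∃ E : ℕ → ℂ, (∀ N, ‖E N‖ ≤ (‖t‖ ^ 2 + ‖t‖) * (2 / (n - 1))) ∧
      Tendsto (fun N => Complex.exp (E N)) atTop
        (𝓝 (Complex.Gamma (n * I + t) / Complex.Gamma (n * I) * Complex.exp (-(t * Complex.log (n * I))))) := by
  set s : ℂ := n * I with hs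
  have hsre : s.re = 0 := by simp [hs]
  have hsim : s.im = n := by simp [hs]
  have hw : ∀ j : ℕ, s + j ≠ 0 := by
    intro j h
    have := congrArg Complex.im h
    simp [hsim] at this; linarith
  have hwt : ∀ j : ℕ, s + t + j ≠ 0 := by
    intro j h
    have := congrArg Complex.im h
    simp [hsim] at this; linarith
  have hnorm2 : ∀ j : ℕ, ‖s + j‖ ^ 2 = n ^ 2 + (j : ℝ) ^ 2 := by
    intro j
    rw [Complex.sq_norm, Complex.normSq_apply]
    simp [hsre, hsim]; ring
  have hnorm : ∀ j : ℕ, n ≤ ‖s + j‖ := by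
    intro j
    have := Complex.abs_im_le_norm (s + j)
    simp [hsim] at this
    exact (le_abs_self n).trans this
  have hG : Complex.Gamma s ≠ 0 := by
    apply Complex.Gamma_ne_zero
    intro m h
    exact hw m (by rw [h]; ring)
  let d : ℕ → ℂ := fun j => Complex.log (1 + t / (s + j)) - t * Complex.log (1 + 1 / (s + j))
  let E : ℕ → ℂ := fun N => - ∑ j ∈ Finset.range (N + 1), d j
  have hexp : ∀ N : ℕ, Complex.exp (∑ j ∈ Finset.range N, d j)
      = (∏ j ∈ Finset.range N, (s + t + j) / (s + j)) *
        Complex.exp (t * Complex.log s - t * Complex.log (s + N)) := by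
    intro N
    induction N with
    | zero => simp
    | succ N ih =>
      rw [Finset.sum_range_succ, Complex.exp_add, ih, Finset.prod_range_succ]
      have hl := log_succ_aux (s + N) (hw N) (by simp [hsre])
      have h1 : (1 + t / (s + N)) = (s + t + N) / (s + N) := by
        have := hw N
        field_simp; ring
      have hne : (1 + t / (s + N)) ≠ 0 := by
        rw [h1]; exact div_ne_zero (hwt N) (hw N)
      have e : Complex.exp (d N) = (s + t + N) / (s + N) *
          Complex.exp (-(t * Complex.log (1 + 1 / (s + N)))) := by
        simp only [d]
        rw [sub_eq_add_neg, Complex.exp_add, Complex.exp_log hne, h1]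
      rw [e]
      have e2 : s + ((N + 1 : ℕ) : ℂ) = s + N + 1 := by push_cast; ring
      rw [e2, hl]
      have e3 : t * Complex.log s - t * (Complex.log (s + N) + Complex.log (1 + 1 / (s + N)))
        = (t * Complex.log s - t * Complex.log (s + N)) + -(t * Complex.log (1 + 1 / (s + N))) := by ring
      rw [e3, Complex.exp_add]
      ring
  refine ⟨E, ?_, ?_⟩
  · intro N
    simp only [E, norm_neg]
    refine (norm_sum_le _ _).trans ?_
    calc ∑ j ∈ Finset.range (N + 1), ‖d j‖
        ≤ ∑ j ∈ Finset.range (N + 1), (‖t‖ ^ 2 + ‖t‖) * (1 / (n ^ 2 + (j : ℝ) ^ 2)) := by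
          apply Finset.sum_le_sum
          intro j _
          have := log_est_aux t (s + j) (hn.trans (hnorm j)) (hnt.trans (hnorm j))
          rw [hnorm2] at this
          rw [mul_one_div]; exact this
      _ ≤ _ := by
          rw [← Finset.mul_sum]
          exact mul_le_mul_of_nonneg_left (sum_est_aux n hn _) (by positivity)
  · have h1 := ((Complex.GammaSeq_tendsto_Gamma (s + t)).div (Complex.GammaSeq_tendsto_Gamma s) hG).mul_const
      (Complex.exp (-(t * Complex.log s)))
    have h2 := h1.div (tail_aux s t) one_ne_zero
    rw [div_one] at h2
    refine h2.congr' ?_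
    filter_upwards [eventually_gt_atTop 0] with N hN
    have hN0 : (N : ℂ) ≠ 0 := by exact_mod_cast hN.ne'
    simp only [E, Pi.div_apply]
    rw [Complex.exp_neg (∑ j ∈ Finset.range (N + 1), d j), hexp, Finset.prod_div_distrib]
    simp only [Complex.GammaSeq]
    have p1 : ∏ j ∈ Finset.range (N + 1), (s + j) ≠ 0 := Finset.prod_ne_zero_iff.mpr fun j _ => hw j
    have p2 : ∏ j ∈ Finset.range (N + 1), (s + t + j) ≠ 0 := Finset.prod_ne_zero_iff.mpr fun j _ => hwt j
    have p3 : (N : ℂ) ^ s ≠ 0 := by simp [Complex.cpow_eq_zero_iff, hN0]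
    have p4 : (N : ℂ) ^ t ≠ 0 := by simp [Complex.cpow_eq_zero_iff, hN0]
    have p5 : ((N.factorial : ℕ) : ℂ) ≠ 0 := by exact_mod_cast N.factorial_ne_zero
    rw [Complex.cpow_add _ _ hN0, Complex.exp_sub, Complex.exp_neg, Complex.exp_neg]
    have p6 := Complex.exp_ne_zero (t * Complex.log s)
    have p7 := Complex.exp_ne_zero (t * Complex.log (s + (N + 1 : ℕ)))
    field_simp

lemma gamma_ratio_tendsto (k : ℕ) :
    Tendsto (fun n : ℕ => Complex.Gamma (((n + k : ℕ) : ℂ) * I) / Complex.Gamma ((n : ℂ) * I) /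
      (Complex.exp (I * Complex.log ((n : ℂ) * I))) ^ k) atTop (𝓝 1) := by
  set t : ℂ := k * I with ht
  set C := ‖t‖ ^ 2 + ‖t‖ with hC
  have hlim : Tendsto (fun n : ℕ => C * (2 / ((n : ℝ) - 1))) atTop (𝓝 0) := by
    have : Tendsto (fun n : ℕ => (n : ℝ) - 1) atTop atTop :=
      tendsto_atTop_add_const_right _ _ tendsto_natCast_atTop_atTop
    simpa using (this.const_div_atTop 2).const_mul C
  rw [tendsto_iff_norm_sub_tendsto_zero]
  have hlim2 := hlim.const_mul 2
  rw [mul_zero] at hlim2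
  refine squeeze_zero' (Eventually.of_forall fun _ => norm_nonneg _) ?_ hlim2
  have hnt : ∀ᶠ n : ℕ in atTop, 2 * ‖t‖ ≤ n :=
    tendsto_natCast_atTop_atTop.eventually_ge_atTop _
  filter_upwards [eventually_ge_atTop 2, hnt, hlim.eventually_le_const zero_lt_one] with n hn hn2 hle
  obtain ⟨E, hE, hT⟩ := gamma_ratio_bound t n (by exact_mod_cast hn) hn2 (by simp [ht]) (by simp [ht])
  have hval : Complex.Gamma (((n + k : ℕ) : ℂ) * I) / Complex.Gamma ((n : ℂ) * I) /
      (Complex.exp (I * Complex.log ((n : ℂ) * I))) ^ k =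
      Complex.Gamma ((n : ℝ) * I + t) / Complex.Gamma ((n : ℝ) * I) *
        Complex.exp (-(t * Complex.log ((n : ℝ) * I))) := by
    rw [← Complex.exp_nat_mul, Complex.exp_neg, div_eq_mul_inv _ (Complex.exp _)]
    congr 2
    · congr 1
      rw [ht]; push_cast; ring
    · simp only [Complex.ofReal_natCast, ht]; ring
  rw [hval]
  refine le_of_tendsto ((hT.sub_const 1).norm) (Eventually.of_forall fun N => ?_)
  have h1 := Complex.norm_exp_sub_one_le ((hE N).trans hle)
  exact h1.trans (mul_le_mul_of_nonneg_left (hE N) (by norm_num))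

lemma poly_tendsto (p : Polynomial ℂ) (D : ℕ) (hD : p.natDegree ≤ D) :
    Tendsto (fun n : ℕ => p.eval (n : ℂ) / (n : ℂ) ^ D) atTop (𝓝 (p.coeff D)) := by
  have h : Tendsto (fun n : ℕ => ∑ i ∈ Finset.range (D + 1), p.coeff i * ((n : ℂ)⁻¹) ^ (D - i)) atTop
      (𝓝 (∑ i ∈ Finset.range (D + 1), p.coeff i * (0 : ℂ) ^ (D - i))) := by
    refine tendsto_finsetSum _ fun i _ => ?_
    exact ((tendsto_inv_atTop_nhds_zero_nat (𝕜 := ℂ)).pow _).const_mul _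
  have e : ∑ i ∈ Finset.range (D + 1), p.coeff i * (0 : ℂ) ^ (D - i) = p.coeff D := by
    rw [Finset.sum_range_succ, Finset.sum_eq_zero]
    · simp
    · intro i hi
      have := Finset.mem_range.mp hi
      rw [zero_pow (by omega), mul_zero]
  rw [e] at h
  refine h.congr' ?_
  filter_upwards [eventually_gt_atTop 0] with n hn
  have hn0 : (n : ℂ) ≠ 0 := by exact_mod_cast hn.ne'
  rw [Polynomial.eval_eq_sum_range' (Nat.lt_succ_of_le hD), Finset.sum_div]
  refine Finset.sum_congr rfl fun i hi => ?_
  have := Finset.mem_range.mp hi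
  have hi' : i ≤ D := by omega
  rw [inv_pow, mul_div_assoc]
  congr 1
  rw [eq_div_iff (pow_ne_zero _ hn0), inv_mul_eq_iff_eq_mul₀ (pow_ne_zero _ hn0), ← pow_add]
  congr 1; omega

/-- The base `w_n = (n i)^i`. -/
lemma w_eq (n : ℕ) (hn : 0 < n) : Complex.exp (I * Complex.log ((n : ℂ) * I)) =
    Complex.exp (-(Real.pi / 2 : ℝ)) * Complex.exp (((Real.log n : ℝ) : ℂ) * I) := by
  have : ((n : ℂ) * I) = ((n : ℝ) : ℂ) * I := by simp
  rw [this, Complex.log_ofReal_mul (by exact_mod_cast hn) I_ne_zero, Complex.log_I, ← Complex.exp_add]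
  congr 1
  push_cast
  linear_combination (Real.pi / 2 : ℂ) * Complex.I_mul_I

lemma w_subseq (θ : ℝ) : ∃ u : ℕ → ℕ, Tendsto u atTop atTop ∧
    Tendsto (fun m => Complex.exp (I * Complex.log ((u m : ℂ) * I))) atTop
      (𝓝 (Complex.exp (-(Real.pi / 2 : ℝ)) * Complex.exp ((θ : ℂ) * I))) := by
  let x : ℕ → ℝ := fun m => Real.exp (θ + m * (2 * Real.pi))
  have hx : Tendsto x atTop atTop := by
    refine Real.tendsto_exp_atTop.comp (tendsto_atTop_add_const_left _ _ ?_)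
    exact tendsto_natCast_atTop_atTop.atTop_mul_const (by positivity)
  have hu : Tendsto (fun m => ⌊x m⌋₊) atTop atTop := tendsto_nat_floor_atTop.comp hx
  refine ⟨fun m => ⌊x m⌋₊, hu, ?_⟩
  have hr : Tendsto (fun m => ((⌊x m⌋₊ : ℕ) : ℝ) / x m) atTop (𝓝 1) :=
    (tendsto_nat_floor_div_atTop (R := ℝ)).comp hx
  have hl := hr.log one_ne_zero
  rw [Real.log_one] at hl
  have hc : Tendsto (fun m => Complex.exp (-(Real.pi / 2 : ℝ)) *
      Complex.exp (((θ + Real.log (((⌊x m⌋₊ : ℕ) : ℝ) / x m) : ℝ) : ℂ) * I)) atTop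
      (𝓝 (Complex.exp (-(Real.pi / 2 : ℝ)) * Complex.exp (((θ + 0 : ℝ) : ℂ) * I))) := by
    have hcont : Continuous fun y : ℝ => Complex.exp (-(Real.pi / 2 : ℝ)) *
      Complex.exp (((θ + y : ℝ) : ℂ) * I) := by fun_prop
    exact (hcont.tendsto 0).comp hl
  rw [add_zero] at hc
  refine hc.congr' ?_
  filter_upwards [hu.eventually_gt_atTop 0] with m hm
  rw [w_eq _ hm]
  congr 1
  have hm' : ((⌊x m⌋₊ : ℕ) : ℝ) ≠ 0 := by exact_mod_cast hm.ne'
  rw [Real.log_div hm' (Real.exp_pos _).ne']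
  simp only [x, Real.log_exp]
  rw [← Complex.exp_periodic.nat_mul m]
  congr 1
  push_cast
  ring

theorem gamma_ni_not_holonomic
    (f : ℕ → ℂ) (hf : ∀ n : ℕ, 1 ≤ n → f n = Complex.Gamma ((n : ℂ) * Complex.I)) :
    ¬ IsHolonomic f := by
  rintro ⟨d, N, p, ⟨k₀, hk₀⟩, hrec⟩
  obtain ⟨k₁, -, hk₁⟩ := Finset.exists_max_image
    (Finset.univ.filter fun k => p k ≠ 0) (fun k => (p k).natDegree) ⟨k₀, by simp [hk₀]⟩ |>.imp
      fun a h => (⟨trivial, h⟩ : True ∧ _)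
  obtain ⟨hk₁0, hk₁max⟩ := hk₁
  have hk₁0 : p k₁ ≠ 0 := by simpa using hk₁0
  set D := (p k₁).natDegree with hDdef
  have hD : ∀ k, (p k).natDegree ≤ D := by
    intro k
    by_cases h : p k = 0
    · simp [h]
    · exact hk₁max k (by simp [h])
  have ha : (p k₁).coeff D ≠ 0 := by
    have := Polynomial.leadingCoeff_ne_zero.mpr hk₁0
    exact this
  let w : ℕ → ℂ := fun n => Complex.exp (I * Complex.log ((n : ℂ) * I))
  let r : ℕ → ℕ → ℂ := fun k n => Complex.Gamma (((n + k : ℕ) : ℂ) * I) /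
    Complex.Gamma ((n : ℂ) * I) / (w n) ^ k
  have hw0 : ∀ n, w n ≠ 0 := fun n => Complex.exp_ne_zero _
  have hzero : ∀ᶠ n : ℕ in atTop, ∑ k : Fin (d + 1),
      ((p k).eval (n : ℂ) / (n : ℂ) ^ D * r k n) * w n ^ (k : ℕ) = 0 := by
    filter_upwards [eventually_ge_atTop N, eventually_ge_atTop 1] with n hn hn1
    have h := hrec n hn
    have e : ∀ k : Fin (d + 1), ((p k).eval (n : ℂ) / (n : ℂ) ^ D * r k n) * w n ^ (k : ℕ) =
        ((p k).eval (n : ℂ) * f (n + (k : ℕ))) * (((n : ℂ) ^ D)⁻¹ * (Complex.Gamma ((n : ℂ) * I))⁻¹) := by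
      intro k
      rw [hf (n + k) (by omega)]
      have := pow_ne_zero (k : ℕ) (hw0 n)
      simp only [r]
      rw [mul_assoc, div_mul_cancel₀ _ this]
      ring
    rw [Finset.sum_congr rfl fun k _ => e k, ← Finset.sum_mul, h, zero_mul]
  let Q : Polynomial ℂ := ∑ k : Fin (d + 1), Polynomial.monomial (k : ℕ) ((p k).coeff D)
  have hroot : ∀ θ : ℝ, Q.eval (Complex.exp (-(Real.pi / 2 : ℝ)) * Complex.exp ((θ : ℂ) * I)) = 0 := by
    intro θ
    obtain ⟨u, hu, hwu⟩ := w_subseq θ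
    have hlim : Tendsto (fun m => ∑ k : Fin (d + 1),
        ((p k).eval (u m : ℂ) / (u m : ℂ) ^ D * r k (u m)) * w (u m) ^ (k : ℕ)) atTop
        (𝓝 (∑ k : Fin (d + 1), ((p k).coeff D * 1) *
          (Complex.exp (-(Real.pi / 2 : ℝ)) * Complex.exp ((θ : ℂ) * I)) ^ (k : ℕ))) := by
      refine tendsto_finsetSum _ fun k _ => ?_
      exact (((poly_tendsto (p k) D (hD k)).comp hu).mul ((gamma_ratio_tendsto k).comp hu)).mul
        (hwu.pow _)
    have hz : Tendsto (fun m => ∑ k : Fin (d + 1),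
        ((p k).eval (u m : ℂ) / (u m : ℂ) ^ D * r k (u m)) * w (u m) ^ (k : ℕ)) atTop (𝓝 0) :=
      tendsto_const_nhds.congr' ((hu.eventually hzero).mono fun m hm => hm.symm)
    have := tendsto_nhds_unique hlim hz
    simpa [Q, Polynomial.eval_finsetSum] using this
  have hQ : Q = 0 := by
    apply Polynomial.eq_zero_of_infinite_isRoot
    have hinj : Set.InjOn (fun θ : ℝ => Complex.exp (-(Real.pi / 2 : ℝ)) * Complex.exp ((θ : ℂ) * I))
        (Set.Ioo 0 1) := by
      intro a ha b hb hab
      have hab := mul_left_cancel₀ (Complex.exp_ne_zero _) hab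
      have h := congrArg Complex.arg hab
      have hpi := Real.pi_gt_three
      rwa [Complex.arg_exp_mul_I, Complex.arg_exp_mul_I,
        (toIocMod_eq_self _).mpr ⟨by linarith [ha.1], by linarith [ha.2]⟩,
        (toIocMod_eq_self _).mpr ⟨by linarith [hb.1], by linarith [hb.2]⟩] at h
    refine ((Set.Ioo_infinite (zero_lt_one' ℝ)).image hinj).mono ?_
    rintro _ ⟨θ, -, rfl⟩
    exact hroot θ
  apply ha
  have hc := congrArg (fun q => Polynomial.coeff q (k₁ : ℕ)) hQ
  simp only [Q, Polynomial.finsetSum_coeff, Polynomial.coeff_monomial, Polynomial.coeff_zero,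
    Fin.val_inj] at hc
  simpa using hc
end

section
/- Let c ∈ ℝ with c ≠ 0 and let θ ∈ (0, 1). Then, as z → +∞ along the positive reals, E(z; c, θ) + 1 is asymptotically equivalent to −(c/Γ(1−θ))·(log z)^{−θ}; that is, E(z; c, θ) = −1 − (c/Γ(1−θ))·(log z)^{−θ} + o((log z)^{−θ}). -/
open MeasureTheory Filter Asymptotics

noncomputable def gG (c θ : ℝ) (s : ℂ) : ℂ :=
  Complex.exp ((c : ℂ) * s ^ (θ : ℂ)) * (↑Real.pi / Complex.sin (↑Real.pi * s))

noncomputable def gG1 (c θ : ℝ) (s : ℂ) : ℂ :=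
  gG c θ s * (c * (θ * s ^ ((θ : ℂ) - 1)) -
    Real.pi * (Complex.cos (Real.pi * s) / Complex.sin (Real.pi * s)))

def gS : Set ℂ := {s | 0 ≤ s.re ∧ s.re ≤ 1 / 2 ∧ s ≠ 0}

lemma gS_slit {s : ℂ} (hs : s ∈ gS) : s ∈ Complex.slitPlane := by
  obtain ⟨h0, h1, h2⟩ := hs
  rw [Complex.mem_slitPlane_iff]
  by_contra! h
  apply h2
  apply Complex.ext
  · simp; linarith [h.1]
  · simpa using h.2

lemma gS_sin {s : ℂ} (hs : s ∈ gS) : Complex.sin (Real.pi * s) ≠ 0 := by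
  obtain ⟨h0, h1, h2⟩ := hs
  intro h
  rw [Complex.sin_eq_zero_iff] at h
  obtain ⟨k, hk⟩ := h
  have hpi : (Real.pi : ℂ) ≠ 0 := by exact_mod_cast Real.pi_ne_zero
  have hsk : s = (k : ℂ) := by
    apply mul_left_cancel₀ hpi
    rw [hk]; ring
  rw [hsk] at h0 h1
  simp only [Complex.intCast_re] at h0 h1
  have a0 : (0:ℤ) ≤ k := by exact_mod_cast h0
  have a1 : k < 1 := by
    have : (k:ℝ) < 1 := by linarith
    exact_mod_cast this
  have : k = 0 := by omega
  apply h2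
  rw [hsk, this]; simp

lemma gG_hasDerivAt (c θ : ℝ) {s : ℂ} (hs : s ∈ gS) :
    HasDerivAt (gG c θ) (gG1 c θ s) s := by
  have h1 : HasDerivAt (fun s : ℂ => Complex.exp ((c : ℂ) * s ^ (θ : ℂ))) _ s :=
    (((hasDerivAt_id s).cpow_const (c := (θ : ℂ)) (gS_slit hs)).const_mul (c : ℂ)).cexp
  have h2 : HasDerivAt (fun s : ℂ => Complex.sin (Real.pi * s)) _ s :=
    ((hasDerivAt_id s).const_mul (Real.pi : ℂ)).csin
  have h3 := h1.mul ((hasDerivAt_const s (Real.pi : ℂ)).div h2 (gS_sin hs))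
  refine h3.congr_deriv ?_
  have := gS_sin hs
  simp only [gG1, gG, id, Pi.div_apply]
  field_simp
  ring

lemma gG1_continuousAt (c θ : ℝ) {s : ℂ} (hs : s ∈ gS) : ContinuousAt (gG1 c θ) s := by
  have h0 := (gG_hasDerivAt c θ hs).continuousAt
  have h1 : ContinuousAt (fun s : ℂ => s ^ ((θ : ℂ) - 1)) s :=
    (continuousAt_id).cpow continuousAt_const (gS_slit hs)
  unfold gG1
  refine h0.mul ((continuousAt_const.mul (continuousAt_const.mul h1)).sub
    (continuousAt_const.mul (ContinuousAt.div ?_ ?_ (gS_sin hs)))) <;> fun_prop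

lemma sin_lower (s : ℂ) (ht : 1 ≤ |s.im|) :
    Real.exp (Real.pi * |s.im|) / 4 ≤ ‖Complex.sin (Real.pi * s)‖ := by
  have e1 : ‖Complex.exp (-(Real.pi * s) * Complex.I)‖ = Real.exp (Real.pi * s.im) := by
    rw [Complex.norm_exp]; simp
  have e2 : ‖Complex.exp ((Real.pi * s) * Complex.I)‖ = Real.exp (-(Real.pi * s.im)) := by
    rw [Complex.norm_exp]; simp
  have e3 : ‖Complex.sin (Real.pi * s)‖ = ‖Complex.exp (-(Real.pi * s) * Complex.I)
      - Complex.exp ((Real.pi * s) * Complex.I)‖ / 2 := by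
    rw [Complex.sin]; simp
  have e4 := abs_norm_sub_norm_le (Complex.exp (-(Real.pi * s) * Complex.I))
    (Complex.exp ((Real.pi * s) * Complex.I))
  rw [e1, e2] at e4
  have key : ∀ x : ℝ, 1 ≤ x → Real.exp (-(Real.pi * x)) ≤ Real.exp (Real.pi * x) / 2 := by
    intro x hx
    have h3 := Real.pi_gt_three
    have a : 1 ≤ Real.pi * x := by nlinarith
    have b : Real.exp (-(Real.pi * x)) ≤ 1 := Real.exp_le_one_iff.2 (by linarith)
    have d := Real.add_one_le_exp (Real.pi * x)
    linarith
  rw [e3]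
  rcases le_total 0 s.im with h | h
  · rw [abs_of_nonneg h] at ht ⊢
    have := key _ ht
    have := le_abs_self (Real.exp (Real.pi * s.im) - Real.exp (-(Real.pi * s.im)))
    linarith
  · rw [abs_of_nonpos h] at ht ⊢
    have := key _ ht
    have := neg_abs_le (Real.exp (Real.pi * s.im) - Real.exp (-(Real.pi * s.im)))
    simp only [mul_neg, neg_neg] at *
    linarith

lemma cos_upper (s : ℂ) : ‖Complex.cos (Real.pi * s)‖ ≤ Real.exp (Real.pi * |s.im|) := by
  have e1 : ‖Complex.exp (-(Real.pi * s) * Complex.I)‖ = Real.exp (Real.pi * s.im) := by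
    rw [Complex.norm_exp]; simp
  have e2 : ‖Complex.exp ((Real.pi * s) * Complex.I)‖ = Real.exp (-(Real.pi * s.im)) := by
    rw [Complex.norm_exp]; simp
  have a1 : Real.exp (Real.pi * s.im) ≤ Real.exp (Real.pi * |s.im|) := by
    gcongr; exact le_abs_self _
  have a2 : Real.exp (-(Real.pi * s.im)) ≤ Real.exp (Real.pi * |s.im|) := by
    rw [← mul_neg]; gcongr; exact neg_le_abs _
  have := norm_add_le (Complex.exp ((Real.pi * s) * Complex.I))
    (Complex.exp (-(Real.pi * s) * Complex.I))
  rw [Complex.cos, norm_div]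
  simp only [Complex.norm_ofNat]
  linarith

lemma pow_bd (c θ : ℝ) (hθ0 : 0 < θ) (hθ1 : θ < 1) :
    ∃ M : ℝ, ∀ x : ℝ, 0 ≤ x → |c| * x ^ θ ≤ x + M := by
  have h : Tendsto (fun x : ℝ => |c| * x ^ (-(1 - θ))) atTop (nhds (|c| * 0)) :=
    (tendsto_rpow_neg_atTop (by linarith)).const_mul _
  rw [mul_zero] at h
  have h2 := h.eventually_le_const one_pos
  obtain ⟨X, hX⟩ := (h2.and (eventually_ge_atTop 1)).exists_forall_of_atTop
  refine ⟨|c| * |X| ^ θ, fun x hx => ?_⟩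
  rcases le_total X x with hh | hh
  · obtain ⟨h3, h4⟩ := hX x hh
    have e : x ^ θ = x ^ (-(1 - θ)) * x := by
      rw [← Real.rpow_add_one (by linarith)]; ring_nf
    have : 0 ≤ |c| * |X| ^ θ := by positivity
    rw [e]
    nlinarith
  · have : x ^ θ ≤ |X| ^ θ := by
      gcongr; exact hh.trans (le_abs_self _)
    have := mul_le_mul_of_nonneg_left this (abs_nonneg c)
    linarith

lemma gG_bd (c θ : ℝ) (hθ0 : 0 < θ) (hθ1 : θ < 1) :
    ∃ C : ℝ, 0 < C ∧ ∀ s : ℂ, s ∈ gS → 1 ≤ |s.im| →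
      ‖gG c θ s‖ ≤ C * Real.exp (-(2 * ‖s‖)) ∧ ‖gG1 c θ s‖ ≤ C * Real.exp (-(2 * ‖s‖)) := by
  obtain ⟨M, hM⟩ := pow_bd c θ hθ0 hθ1
  have hp := Real.pi_pos
  have hp3 := Real.pi_gt_three
  have main : ∀ s : ℂ, s ∈ gS → 1 ≤ |s.im| →
      ‖gG c θ s‖ ≤ (4 * Real.pi * Real.exp (M + 3 / 2)) * Real.exp (-(2 * ‖s‖)) := by
    intro s hs ht
    have hsin := sin_lower s ht
    have hn : ‖s‖ ≤ 1 / 2 + |s.im| := by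
      have := Complex.norm_le_abs_re_add_abs_im s
      rw [abs_of_nonneg hs.1] at this
      linarith [hs.2.1]
    have h1 : ‖Complex.exp ((c : ℂ) * s ^ (θ : ℂ))‖ ≤ Real.exp (‖s‖ + M) := by
      refine (Complex.norm_exp_le_exp_norm _).trans ?_
      rw [norm_mul, Complex.norm_cpow_real, Complex.norm_real, Real.norm_eq_abs]
      exact Real.exp_le_exp.2 (hM _ (norm_nonneg _))
    have h2 : ‖(↑Real.pi / Complex.sin (↑Real.pi * s))‖ ≤
        4 * Real.pi * Real.exp (-(3 * (‖s‖ - 1 / 2))) := by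
      rw [norm_div, Complex.norm_real, Real.norm_of_nonneg hp.le]
      rw [div_le_iff₀ (lt_of_lt_of_le (by positivity) hsin)]
      have : Real.exp (3 * (‖s‖ - 1 / 2)) ≤ Real.exp (Real.pi * |s.im|) :=
        Real.exp_le_exp.2 (by nlinarith [abs_nonneg s.im])
      calc Real.pi = 4 * Real.pi * Real.exp (-(3 * (‖s‖ - 1 / 2))) *
            (Real.exp (3 * (‖s‖ - 1 / 2)) / 4) := by
            rw [Real.exp_neg]; field_simp
        _ ≤ _ := by gcongr; linarith
    calc ‖gG c θ s‖ ≤ Real.exp (‖s‖ + M) * (4 * Real.pi * Real.exp (-(3 * (‖s‖ - 1 / 2)))) := by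
          rw [gG, norm_mul]; gcongr
      _ = _ := by
          rw [mul_left_comm, ← Real.exp_add, mul_assoc (4 * Real.pi), ← Real.exp_add]; ring_nf
  refine ⟨(4 * Real.pi * Real.exp (M + 3 / 2)) * (|c| + 4 * Real.pi), by positivity, fun s hs ht => ⟨?_, ?_⟩⟩
  · refine (main s hs ht).trans ?_
    have : 1 ≤ |c| + 4 * Real.pi := by linarith [abs_nonneg c]
    refine mul_le_mul_of_nonneg_right ?_ (Real.exp_pos _).le
    exact le_mul_of_one_le_right (by positivity) this
  · have h1 : ‖c * (θ * s ^ ((θ : ℂ) - 1)) -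
        Real.pi * (Complex.cos (Real.pi * s) / Complex.sin (Real.pi * s))‖ ≤ |c| + 4 * Real.pi := by
      refine (norm_sub_le _ _).trans (add_le_add ?_ ?_)
      · have : ((θ : ℂ) - 1) = ((θ - 1 : ℝ) : ℂ) := by push_cast; ring
        rw [norm_mul, norm_mul, this, Complex.norm_cpow_real, Complex.norm_real, Complex.norm_real,
          Real.norm_eq_abs, Real.norm_of_nonneg hθ0.le]
        have : ‖s‖ ^ (θ - 1) ≤ 1 :=
          Real.rpow_le_one_of_one_le_of_nonpos (ht.trans (Complex.abs_im_le_norm s)) (by linarith)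
        refine mul_le_of_le_one_right (abs_nonneg _) (mul_le_one₀ hθ1.le (by positivity) this)
      · rw [norm_mul, norm_div, Complex.norm_real, Real.norm_of_nonneg hp.le, mul_comm 4]
        have hsin := sin_lower s ht
        gcongr
        rw [div_le_iff₀ (lt_of_lt_of_le (by positivity) hsin)]
        linarith [cos_upper s]
    rw [gG1, norm_mul]
    calc _ ≤ ((4 * Real.pi * Real.exp (M + 3 / 2)) * Real.exp (-(2 * ‖s‖))) * (|c| + 4 * Real.pi) := by
          gcongr
          exact main s hs ht
      _ = _ := by ring

noncomputable def gQ (c θ : ℝ) (s : ℂ) : ℂ := (gG1 c θ s + 1 / s ^ 2) * s ^ (2 - (θ : ℂ))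

noncomputable def gH (s : ℂ) : ℂ := Real.pi / dslope (fun s : ℂ => Complex.sin (Real.pi * s)) 0 s

lemma sin_hd (s : ℂ) : HasDerivAt (fun s : ℂ => Complex.sin (Real.pi * s))
    (Real.pi * Complex.cos (Real.pi * s)) s := by
  refine (((hasDerivAt_id s).const_mul (Real.pi : ℂ)).csin).congr_deriv ?_
  simp; ring

lemma gH_zero : gH 0 = 1 := by
  rw [gH, dslope_same, (sin_hd 0).deriv]
  simp

lemma gH_of_ne {s : ℂ} (hs : s ≠ 0) : gH s = Real.pi * s / Complex.sin (Real.pi * s) := by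
  rw [gH, dslope_of_ne _ hs, slope_def_field]
  simp [div_div_eq_mul_div]

lemma gH_analytic : AnalyticAt ℂ gH 0 := by
  have hd : Differentiable ℂ (dslope (fun s : ℂ => Complex.sin (Real.pi * s)) 0) := by
    rw [← differentiableOn_univ, Complex.differentiableOn_dslope Filter.univ_mem]
    intro s _
    exact (sin_hd s).differentiableAt.differentiableWithinAt
  refine AnalyticAt.div analyticAt_const (hd.analyticAt 0) ?_
  rw [dslope_same, (sin_hd 0).deriv]
  simp

lemma gH_deriv {s : ℂ} (hs : s ∈ gS) : deriv gH s =
    (Real.pi * Complex.sin (Real.pi * s) - Real.pi * s * (Real.pi * Complex.cos (Real.pi * s))) /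
      Complex.sin (Real.pi * s) ^ 2 := by
  have h1 : gH =ᶠ[nhds s] fun s => Real.pi * s / Complex.sin (Real.pi * s) := by
    filter_upwards [isOpen_ne.mem_nhds hs.2.2] with w hw using gH_of_ne hw
  rw [h1.deriv_eq]
  have := (((hasDerivAt_id s).const_mul (Real.pi : ℂ)).div (sin_hd s) (gS_sin hs)).deriv
  rw [mul_one] at this
  exact this

lemma gQ_eq (c θ : ℝ) {s : ℂ} (hs : s ∈ gS) :
    gQ c θ s = Complex.exp (c * s ^ (θ : ℂ)) * (c * θ) * gH s
      + Complex.exp (c * s ^ (θ : ℂ)) * deriv gH s * s ^ (1 - (θ : ℂ))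
      - ((s ^ (θ : ℂ))⁻¹ * (Complex.exp (c * s ^ (θ : ℂ)) - 1)) * gH s
      - (s⁻¹ * (gH s - 1)) * s ^ (1 - (θ : ℂ)) := by
  have h0 : s ≠ 0 := hs.2.2
  have hsin := gS_sin hs
  have hu : s ^ (θ : ℂ) ≠ 0 := by simp [Complex.cpow_eq_zero_iff, h0]
  rw [gQ, gG1, gG, gH_deriv hs, gH_of_ne h0, Complex.cpow_sub _ _ h0, Complex.cpow_sub _ _ h0,
    Complex.cpow_sub _ _ h0, Complex.cpow_one, Complex.cpow_ofNat]
  generalize Complex.exp (c * s ^ (θ : ℂ)) = e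
  generalize s ^ (θ : ℂ) = u at *
  field_simp
  ring

lemma cpow_tendsto {β : ℝ} (hβ : 0 < β) :
    Tendsto (fun s : ℂ => s ^ (β : ℂ)) (nhdsWithin 0 gS) (nhds 0) := by
  rw [tendsto_zero_iff_norm_tendsto_zero]
  simp_rw [Complex.norm_cpow_real]
  have : Tendsto (fun s : ℂ => ‖s‖ ^ β) (nhds 0) (nhds (‖(0:ℂ)‖ ^ β)) :=
    (continuous_norm.tendsto (0:ℂ)).rpow_const (Or.inr hβ.le)
  rw [norm_zero, Real.zero_rpow hβ.ne'] at this
  exact this.mono_left nhdsWithin_le_nhds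

lemma gQ_tendsto (c θ : ℝ) (hθ0 : 0 < θ) (hθ1 : θ < 1) :
    Tendsto (gQ c θ) (nhdsWithin 0 gS) (nhds (c * (θ - 1))) := by
  have hu := cpow_tendsto hθ0
  have hv := cpow_tendsto (β := 1 - θ) (by linarith)
  have hne : ∀ᶠ s in nhdsWithin (0:ℂ) gS, s ≠ 0 := by
    filter_upwards [self_mem_nhdsWithin] with s hs using hs.2.2
  have hH : Tendsto gH (nhdsWithin 0 gS) (nhds 1) := by
    have := gH_analytic.continuousAt.tendsto
    rw [gH_zero] at this
    exact this.mono_left nhdsWithin_le_nhds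
  have hH' : Tendsto (deriv gH) (nhdsWithin 0 gS) (nhds (deriv gH 0)) :=
    gH_analytic.deriv.continuousAt.tendsto.mono_left nhdsWithin_le_nhds
  have hHs : Tendsto (fun s : ℂ => s⁻¹ * (gH s - 1)) (nhdsWithin 0 gS) (nhds (deriv gH 0)) := by
    have h := gH_analytic.differentiableAt.hasDerivAt.tendsto_slope
    have h2 : nhdsWithin (0:ℂ) gS ≤ nhdsWithin 0 {0}ᶜ :=
      nhdsWithin_mono _ fun s hs => hs.2.2
    refine (h.mono_left h2).congr fun s => ?_
    rw [slope_def_field, gH_zero, sub_zero, div_eq_inv_mul]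
  have he : Tendsto (fun s : ℂ => Complex.exp (c * s ^ (θ : ℂ))) (nhdsWithin 0 gS) (nhds 1) := by
    have h : Tendsto (fun u : ℂ => Complex.exp (c * u)) (nhds 0) (nhds (Complex.exp (c * 0))) := by
      apply Continuous.tendsto; fun_prop
    rw [mul_zero, Complex.exp_zero] at h
    exact h.comp hu
  have hes : Tendsto (fun s : ℂ => (s ^ (θ : ℂ))⁻¹ * (Complex.exp (c * s ^ (θ : ℂ)) - 1))
      (nhdsWithin 0 gS) (nhds c) := by
    have h : HasDerivAt (fun u : ℂ => Complex.exp (c * u)) c 0 := by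
      refine (((hasDerivAt_id (0:ℂ)).const_mul (c : ℂ)).cexp).congr_deriv ?_
      simp
    have hu2 : Tendsto (fun s : ℂ => s ^ (θ : ℂ)) (nhdsWithin 0 gS) (nhdsWithin 0 {0}ᶜ) := by
      apply tendsto_nhdsWithin_of_tendsto_nhds_of_eventually_within _ hu
      filter_upwards [hne] with s hs
      simp [Complex.cpow_eq_zero_iff, hs]
    refine (h.tendsto_slope.comp hu2).congr fun s => ?_
    simp only [Function.comp, slope_def_field]
    simp [div_eq_inv_mul]
  have key := (((he.mul_const ((c : ℂ) * θ)).mul hH).add ((he.mul hH').mul hv)).sub (hes.mul hH)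
    |>.sub (hHs.mul hv)
  have e : (1 * ((c : ℂ) * θ) * 1 + 1 * deriv gH 0 * 0 - c * 1 - deriv gH 0 * 0) = c * (θ - 1) := by
    ring
  rw [e] at key
  refine key.congr' ?_
  filter_upwards [self_mem_nhdsWithin] with s hs
  rw [gQ_eq c θ hs]
  push_cast
  rfl

lemma gQ_bounded (c θ : ℝ) (hθ0 : 0 < θ) (hθ1 : θ < 1) :
    ∃ C : ℝ, ∀ s ∈ gS, ‖gQ c θ s‖ ≤ C := by
  have h1 := (gQ_tendsto c θ hθ0 hθ1).norm.eventually_le_const (lt_add_one _)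
  rw [eventually_nhdsWithin_iff] at h1
  obtain ⟨r, hr, hball⟩ := Metric.eventually_nhds_iff.1 h1
  obtain ⟨C, hC, hfar⟩ := gG_bd c θ hθ0 hθ1
  have h2e : (2 - (θ : ℂ)) = ((2 - θ : ℝ) : ℂ) := by push_cast; rfl
  have hcomp : IsCompact ((Set.Icc 0 (1/2) ×ℂ Set.Icc (-1) 1) ∩ {s : ℂ | r ≤ ‖s‖}) :=
    (isCompact_Icc.reProdIm isCompact_Icc).inter_right (isClosed_le continuous_const continuous_norm)
  have hcont : ContinuousOn (gQ c θ) ((Set.Icc 0 (1/2) ×ℂ Set.Icc (-1) 1) ∩ {s : ℂ | r ≤ ‖s‖}) := by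
    intro s hs
    have hn : s ≠ 0 := by
      rintro rfl
      have := hs.2
      simp at this
      linarith
    have hs' : s ∈ gS := ⟨hs.1.1.1, hs.1.1.2, hn⟩
    apply ContinuousAt.continuousWithinAt
    refine ((gG1_continuousAt c θ hs').add ?_).mul
      (continuousAt_id.cpow continuousAt_const (gS_slit hs'))
    exact ContinuousAt.div continuousAt_const (by fun_prop) (by positivity)
  obtain ⟨D, hD⟩ := hcomp.exists_bound_of_continuousOn hcont
  refine ⟨max (‖(c * (θ - 1) : ℂ)‖ + 1) (max D (C + 1)), fun s hs => ?_⟩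
  by_cases hsr : ‖s‖ < r
  · exact (hball (by simpa using hsr) hs).trans (le_max_left _ _)
  · push Not at hsr
    refine le_trans ?_ (le_max_right _ _)
    by_cases ht : |s.im| ≤ 1
    · refine (hD s ⟨⟨⟨hs.1, hs.2.1⟩, abs_le.1 ht⟩, hsr⟩).trans (le_max_left _ _)
    · push Not at ht
      refine le_trans ?_ (le_max_right _ _)
      have h1s : 1 ≤ ‖s‖ := ht.le.trans (Complex.abs_im_le_norm s)
      have hp : ‖s‖ ^ (2 - θ) ≤ ‖s‖ ^ 2 := by
        rw [← Real.rpow_two]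
        exact Real.rpow_le_rpow_of_exponent_le h1s (by linarith)
      have hx : ‖s‖ ≤ Real.exp ‖s‖ := by linarith [Real.add_one_le_exp ‖s‖]
      have hx2 : Real.exp (-(2 * ‖s‖)) * ‖s‖ ^ 2 ≤ 1 := by
        rw [Real.exp_neg, inv_mul_le_iff₀ (Real.exp_pos _), mul_one,
          two_mul, Real.exp_add, sq]
        gcongr
      rw [gQ, norm_mul, h2e, Complex.norm_cpow_real]
      calc _ ≤ (C * Real.exp (-(2 * ‖s‖)) + 1 / ‖s‖ ^ 2) * ‖s‖ ^ 2 := by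
            gcongr
            refine (norm_add_le _ _).trans ?_
            gcongr
            · exact (hfar s hs ht.le).2
            · simp
        _ = C * (Real.exp (-(2 * ‖s‖)) * ‖s‖ ^ 2) + 1 := by field_simp
        _ ≤ C * 1 + 1 := by gcongr
        _ = _ := by ring


lemma norm_ofReal_rpow_mul_cexp {x b : ℝ} (hx : 0 < x) (r : ℂ) :
    ‖((x ^ b : ℝ) : ℂ) * Complex.exp (-(r * x))‖ = x ^ b * Real.exp (-(r.re * x)) := by
  rw [norm_mul, Complex.norm_real, Complex.norm_exp, Real.norm_of_nonneg (by positivity)]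
  simp

lemma lap_meas (b : ℝ) (r : ℂ) : AEStronglyMeasurable
    (fun x : ℝ => ((x ^ b : ℝ) : ℂ) * Complex.exp (-(r * x))) (volume.restrict (Set.Ioi 0)) := by
  apply Measurable.aestronglyMeasurable
  fun_prop

lemma lap_int_real {b ρ : ℝ} (hb : -1 < b) (hρ : 0 < ρ) :
    IntegrableOn (fun x : ℝ => x ^ b * Real.exp (-(ρ * x))) (Set.Ioi 0) := by
  have := integrableOn_rpow_mul_exp_neg_mul_rpow hb one_pos hρ
  simpa using this

lemma lap_int {b : ℝ} (hb : -1 < b) {r : ℂ} (hr : 0 < r.re) :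
    IntegrableOn (fun x : ℝ => ((x ^ b : ℝ) : ℂ) * Complex.exp (-(r * x))) (Set.Ioi 0) := by
  refine Integrable.mono' (lap_int_real hb hr) (lap_meas b r) ?_
  filter_upwards [ae_restrict_mem measurableSet_Ioi] with x hx
  exact (norm_ofReal_rpow_mul_cexp hx r).le

lemma lap_diff {b : ℝ} (hb : -1 < b) {r : ℂ} (hr : 0 < r.re) : DifferentiableAt ℂ
    (fun r : ℂ => ∫ x in Set.Ioi (0:ℝ), ((x ^ b : ℝ) : ℂ) * Complex.exp (-(r * x))) r := by
  have hs : {w : ℂ | r.re / 2 < w.re} ∈ nhds r :=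
    (isOpen_lt continuous_const Complex.continuous_re).mem_nhds (by simp; linarith)
  refine (hasDerivAt_integral_of_dominated_loc_of_deriv_le (μ := volume.restrict (Set.Ioi (0:ℝ)))
    (F := fun (r : ℂ) (x : ℝ) => ((x ^ b : ℝ) : ℂ) * Complex.exp (-(r * x)))
    (F' := fun (r : ℂ) (x : ℝ) => -(((x ^ (b + 1) : ℝ) : ℂ) * Complex.exp (-(r * x))))
    (bound := fun x => x ^ (b + 1) * Real.exp (-(r.re / 2 * x))) hs
    (Eventually.of_forall fun w => lap_meas b w) (lap_int hb hr) (lap_meas _ r).neg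
    ?_ (lap_int_real (by linarith) (by linarith)) ?_).2.differentiableAt
  · filter_upwards [ae_restrict_mem measurableSet_Ioi] with x hx w hw
    have hx' : 0 < x := hx
    have hw' : r.re / 2 < w.re := hw
    rw [norm_neg, norm_ofReal_rpow_mul_cexp hx]
    gcongr
  · filter_upwards [ae_restrict_mem measurableSet_Ioi] with x hx w hw
    have h := (((hasDerivAt_id w).mul_const (x : ℂ)).neg.cexp).const_mul (((x ^ b : ℝ) : ℂ))
    refine h.congr_deriv ?_
    rw [Real.rpow_add_one (ne_of_gt hx)]
    push_cast
    simp
    ring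

lemma gamma_laplace {a : ℝ} (ha : 0 < a) {r : ℂ} (hr : 0 < r.re) :
    ∫ x in Set.Ioi (0:ℝ), ((x ^ (a - 1) : ℝ) : ℂ) * Complex.exp (-(r * x)) =
      Real.Gamma a * r ^ (-(a : ℂ)) := by
  have hopen : IsOpen {w : ℂ | 0 < w.re} := isOpen_lt continuous_const Complex.continuous_re
  have h1 : AnalyticOnNhd ℂ (fun r : ℂ => ∫ x in Set.Ioi (0:ℝ),
      ((x ^ (a - 1) : ℝ) : ℂ) * Complex.exp (-(r * x))) {w : ℂ | 0 < w.re} := by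
    apply DifferentiableOn.analyticOnNhd _ hopen
    intro w hw
    exact (lap_diff (by linarith) hw).differentiableWithinAt
  have h2 : AnalyticOnNhd ℂ (fun r : ℂ => Real.Gamma a * r ^ (-(a : ℂ))) {w : ℂ | 0 < w.re} := by
    apply DifferentiableOn.analyticOnNhd _ hopen
    intro w hw
    apply DifferentiableAt.differentiableWithinAt
    refine (DifferentiableAt.cpow_const differentiableAt_id (Or.inl hw)).const_mul _
  have hpre : IsPreconnected {w : ℂ | 0 < w.re} := (convex_halfSpace_re_gt 0).isPreconnected
  have hreal : ∀ r : ℝ, 0 < r → ∫ x in Set.Ioi (0:ℝ), ((x ^ (a - 1) : ℝ) : ℂ) *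
      Complex.exp (-((r : ℂ) * x)) = Real.Gamma a * (r : ℂ) ^ (-(a : ℂ)) := by
    intro r hr
    have := Real.integral_rpow_mul_exp_neg_mul_Ioi ha hr
    have e : ∀ x : ℝ, ((x ^ (a - 1) : ℝ) : ℂ) * Complex.exp (-((r : ℂ) * x)) =
        ((x ^ (a - 1) * Real.exp (-(r * x)) : ℝ) : ℂ) := by intro x; push_cast; rfl
    simp_rw [e]
    rw [integral_complex_ofReal, this, one_div, Real.inv_rpow hr.le, ← Real.rpow_neg hr.le,
      Complex.ofReal_mul, Complex.ofReal_cpow hr.le, mul_comm]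
    simp
  have hfreq : ∃ᶠ w in nhdsWithin (1:ℂ) {1}ᶜ, (∫ x in Set.Ioi (0:ℝ),
      ((x ^ (a - 1) : ℝ) : ℂ) * Complex.exp (-(w * x))) = Real.Gamma a * w ^ (-(a : ℂ)) := by
    have ht : Tendsto (fun x : ℝ => (x : ℂ)) (nhdsWithin 1 (Set.Ioi 1)) (nhdsWithin (1:ℂ) {1}ᶜ) := by
      apply tendsto_nhdsWithin_of_tendsto_nhds_of_eventually_within
      · have : Tendsto (fun x : ℝ => (x : ℂ)) (nhds 1) (nhds ((1:ℝ):ℂ)) :=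
          Complex.continuous_ofReal.tendsto 1
        rw [Complex.ofReal_one] at this
        exact this.mono_left nhdsWithin_le_nhds
      · filter_upwards [self_mem_nhdsWithin] with x hx
        have : (1:ℝ) < x := hx
        simp only [Set.mem_compl_iff, Set.mem_singleton_iff]
        exact_mod_cast this.ne'
    apply ht.frequently
    apply Eventually.frequently
    filter_upwards [self_mem_nhdsWithin] with x hx
    exact hreal x (lt_trans one_pos hx)
  exact h1.eqOn_of_preconnected_of_frequently_eq h2 hpre (by simp) hfreq hr

open FourierTransform in
lemma inv_int_aux (a : ℝ) (ha : 1 < a) :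
    Integrable (fun t : ℝ => (1 + (t : ℂ) * Complex.I) ^ (-(a : ℂ))) := by
  have h1 : Integrable (fun t : ℝ => (1 + ‖t‖ ^ 2) ^ (-a / 2)) :=
    integrable_rpow_neg_one_add_norm_sq (by simpa using ha)
  refine h1.mono' ?_ (Eventually.of_forall fun t => ?_)
  · apply Continuous.aestronglyMeasurable
    apply Continuous.cpow (by fun_prop) (by fun_prop)
    intro t; left; simp
  · rw [← Complex.ofReal_neg, Complex.norm_cpow_real]
    have : ‖(1 + (t : ℂ) * Complex.I)‖ = (1 + ‖t‖ ^ 2) ^ (1 / 2 : ℝ) := by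
      rw [← Real.sqrt_eq_rpow, ← Complex.ofReal_one, Complex.norm_add_mul_I]; simp
    rw [this, ← Real.rpow_mul (by positivity)]
    apply le_of_eq; ring_nf

open FourierTransform in
lemma inv_laplace (a : ℝ) (ha : 1 < a) :
    ∫ t : ℝ, (1 + (t : ℂ) * Complex.I) ^ (-(a : ℂ)) * Complex.exp (1 + t * Complex.I) =
      2 * Real.pi / Real.Gamma a := by
  have hG : (Real.Gamma a : ℂ) ≠ 0 := by
    exact_mod_cast (Real.Gamma_pos_of_pos (by linarith)).ne'
  have hpi := Real.pi_pos
  have hpi' : (Real.pi : ℂ) ≠ 0 := by exact_mod_cast hpi.ne'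
  set f : ℝ → ℂ := fun x => (((max x 0) ^ (a - 1) : ℝ) : ℂ) * Complex.exp (-x) with hf
  have hcont : Continuous f := by
    refine (Complex.continuous_ofReal.comp (Continuous.rpow_const (by fun_prop)
      (fun x => Or.inr (by linarith)))).mul (by fun_prop)
  have hzero : ∀ x : ℝ, x ∉ Set.Ioi (0:ℝ) → f x = 0 := by
    intro x hx
    simp only [Set.mem_Ioi, not_lt] at hx
    simp [hf, max_eq_right hx, Real.zero_rpow (by linarith : a - 1 ≠ 0)]
  have hint : Integrable f := by
    rw [← integrableOn_iff_integrable_of_support_subset (s := Set.Ioi 0)]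
    · refine (lap_int (b := a - 1) (r := 1) (by linarith) (by simp)).congr_fun ?_ measurableSet_Ioi
      intro x hx
      simp [hf, max_eq_left (le_of_lt (Set.mem_Ioi.1 hx))]
    · intro x hx
      by_contra h
      exact hx (hzero x h)
  have hF : ∀ ξ : ℝ, 𝓕 f ξ = Real.Gamma a * (1 + ((2 * Real.pi * ξ : ℝ) : ℂ) * Complex.I) ^ (-(a : ℂ)) := by
    intro ξ
    rw [Real.fourier_real_eq_integral_exp_smul,
      ← gamma_laplace (by linarith) (by simp),
      ← setIntegral_eq_integral_of_forall_compl_eq_zero (s := Set.Ioi 0)]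
    · refine setIntegral_congr_fun measurableSet_Ioi fun x hx => ?_
      simp only [hf, max_eq_left (le_of_lt (Set.mem_Ioi.1 hx)), smul_eq_mul]
      rw [mul_left_comm, ← Complex.exp_add]
      congr 2
      push_cast; ring
    · intro x hx
      simp [hzero x hx]
  have hFint : Integrable (𝓕 f) := by
    have : (𝓕 f) = fun ξ : ℝ => Real.Gamma a * (1 + ((2 * Real.pi * ξ : ℝ) : ℂ) * Complex.I) ^ (-(a : ℂ)) :=
      funext hF
    rw [this]
    exact ((inv_int_aux a ha).comp_mul_left' (R := 2 * Real.pi) (by positivity)).const_mul _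
  have hinv := hint.fourierInv_fourier_eq hFint (v := 1) hcont.continuousAt
  rw [Real.fourierInv_eq'] at hinv
  simp_rw [hF] at hinv
  have e := Measure.integral_comp_mul_left (fun t : ℝ => (1 + (t : ℂ) * Complex.I) ^ (-(a : ℂ)) * Complex.exp (1 + t * Complex.I)) (2 * Real.pi)
  have e2 : (fun v : ℝ => Complex.exp (↑(2 * Real.pi * inner ℝ v 1) * Complex.I) •
      (↑(Real.Gamma a) * (1 + ((2 * Real.pi * v : ℝ) : ℂ) * Complex.I) ^ (-(a : ℂ)))) = fun v : ℝ =>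
      (Real.Gamma a * Complex.exp (-1)) *
      ((1 + ((2 * Real.pi * v : ℝ) : ℂ) * Complex.I) ^ (-(a : ℂ)) *
        Complex.exp (1 + ((2 * Real.pi * v : ℝ) : ℂ) * Complex.I)) := by
    funext v
    rw [Complex.exp_add, Complex.exp_neg]
    simp
    field_simp
  rw [e2, integral_const_mul, e, abs_of_pos (by positivity)] at hinv
  simp only [hf, Complex.real_smul] at hinv
  have he : Complex.exp (-1) ≠ 0 := Complex.exp_ne_zero _
  simp at hinv
  field_simp at hinv
  rw [eq_div_iff hG]
  linear_combination hinv

lemma line_integrable (f : ℝ → ℂ) (hc : Continuous f) (C : ℝ)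
    (h : ∀ t : ℝ, 1 ≤ |t| → ‖f t‖ ≤ C * Real.exp (-(2 * |t|))) : Integrable f := by
  obtain ⟨B, hB⟩ := (isCompact_Icc (a := (-1:ℝ)) (b := 1)).exists_bound_of_continuousOn hc.continuousOn
  refine (integrable_inv_one_add_sq.const_mul (|C| + 2 * |B|)).mono' hc.aestronglyMeasurable
    (Eventually.of_forall fun t => ?_)
  rw [← div_eq_mul_inv, le_div_iff₀ (by positivity)]
  by_cases ht : 1 ≤ |t|
  · have h1 := h t ht
    have h2 : (1 + t ^ 2) ≤ Real.exp (2 * |t|) := by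
      rw [two_mul, Real.exp_add, ← sq_abs t]
      have := Real.add_one_le_exp |t|
      nlinarith [abs_nonneg t]
    have h3 : Real.exp (-(2 * |t|)) * Real.exp (2 * |t|) = 1 := by
      rw [← Real.exp_add]; simp
    calc ‖f t‖ * (1 + t ^ 2) ≤ (|C| * Real.exp (-(2 * |t|))) * Real.exp (2 * |t|) := by
          gcongr
          exact h1.trans (by gcongr; exact le_abs_self _)
      _ = |C| := by rw [mul_assoc, h3, mul_one]
      _ ≤ _ := by linarith [abs_nonneg B]
  · push Not at ht
    have h1 := hB t (abs_le.1 ht.le)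
    have h2 : t ^ 2 ≤ 1 := by rw [← sq_abs]; nlinarith [abs_nonneg t]
    have h4 : ‖f t‖ ≤ |B| := h1.trans (le_abs_self _)
    nlinarith [abs_nonneg C, norm_nonneg (f t), sq_nonneg t]

lemma gS_line {σ : ℝ} (h0 : 0 < σ) (h1 : σ ≤ 1 / 2) (t : ℝ) : (σ + t * Complex.I : ℂ) ∈ gS := by
  refine ⟨by simpa using h0.le, by simpa using h1, fun h => ?_⟩
  have := congrArg Complex.re h
  simp at this
  linarith

lemma line_bd {C L : ℝ} {σ t : ℝ} (hC : 0 < C) {g : ℂ}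
    (hg : ‖g‖ ≤ C * Real.exp (-(2 * ‖(σ + t * Complex.I : ℂ)‖))) :
    ‖g * Complex.exp (L * (σ + t * Complex.I))‖ ≤ (C * Real.exp (L * σ)) * Real.exp (-(2 * |t|)) := by
  have h1 : |t| ≤ ‖(σ + t * Complex.I : ℂ)‖ := by
    simpa using Complex.abs_im_le_norm (σ + t * Complex.I : ℂ)
  have h2 : ‖Complex.exp (L * (σ + t * Complex.I))‖ = Real.exp (L * σ) := by
    rw [Complex.norm_exp]; simp
  rw [norm_mul, h2]
  calc _ ≤ (C * Real.exp (-(2 * |t|))) * Real.exp (L * σ) := by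
        gcongr
        exact hg.trans (by gcongr)
    _ = _ := by ring

lemma line_cont (c θ : ℝ) {σ : ℝ} (h0 : 0 < σ) (h1 : σ ≤ 1 / 2) (L : ℝ) :
    Continuous (fun t : ℝ => gG c θ (σ + t * Complex.I) * Complex.exp (L * (σ + t * Complex.I))) ∧
    Continuous (fun t : ℝ => gG1 c θ (σ + t * Complex.I) * Complex.exp (L * (σ + t * Complex.I))) := by
  constructor
  · refine Continuous.mul ?_ (by fun_prop)
    rw [continuous_iff_continuousAt]
    intro t
    exact ContinuousAt.comp (f := fun t : ℝ => (σ + t * Complex.I : ℂ))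
      (gG_hasDerivAt c θ (gS_line h0 h1 t)).continuousAt (by fun_prop)
  · refine Continuous.mul ?_ (by fun_prop)
    rw [continuous_iff_continuousAt]
    intro t
    exact ContinuousAt.comp (f := fun t : ℝ => (σ + t * Complex.I : ℂ))
      (gG1_continuousAt c θ (gS_line h0 h1 t)) (by fun_prop)

lemma line_int (c θ : ℝ) (hθ0 : 0 < θ) (hθ1 : θ < 1) {σ : ℝ} (h0 : 0 < σ) (h1 : σ ≤ 1 / 2) (L : ℝ) :
    Integrable (fun t : ℝ => gG c θ (σ + t * Complex.I) * Complex.exp (L * (σ + t * Complex.I))) ∧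
    Integrable (fun t : ℝ => gG1 c θ (σ + t * Complex.I) * Complex.exp (L * (σ + t * Complex.I))) := by
  obtain ⟨C, hC, hb⟩ := gG_bd c θ hθ0 hθ1
  have hb' := fun t : ℝ => hb _ (gS_line h0 h1 t)
  simp only [Complex.add_im, Complex.ofReal_im, Complex.mul_im, Complex.ofReal_re, Complex.I_im,
    mul_one, Complex.I_re, mul_zero, add_zero, zero_add] at hb'
  exact ⟨line_integrable _ (line_cont c θ h0 h1 L).1 _ fun t ht => line_bd hC (hb' t ht).1,
    line_integrable _ (line_cont c θ h0 h1 L).2 _ fun t ht => line_bd hC (hb' t ht).2⟩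

lemma shift_line (c θ : ℝ) (hθ0 : 0 < θ) (hθ1 : θ < 1) {σ : ℝ} (h0 : 0 < σ) (h1 : σ ≤ 1 / 2) {L : ℝ} (hL : 0 ≤ L) :
    ∫ t : ℝ, gG c θ ((1 / 2 : ℝ) + t * Complex.I) * Complex.exp (L * ((1 / 2 : ℝ) + t * Complex.I)) =
    ∫ t : ℝ, gG c θ (σ + t * Complex.I) * Complex.exp (L * (σ + t * Complex.I)) := by
  obtain ⟨C, hC, hb⟩ := gG_bd c θ hθ0 hθ1
  set F : ℂ → ℂ := fun s => gG c θ s * Complex.exp (L * s) with hF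
  have hrect : ∀ T : ℝ, (∫ x : ℝ in σ..(1/2), F (x + (-T : ℝ) * Complex.I)) -
      (∫ x : ℝ in σ..(1/2), F (x + T * Complex.I)) +
      Complex.I • (∫ y : ℝ in (-T)..T, F ((1/2 : ℝ) + y * Complex.I)) -
      Complex.I • (∫ y : ℝ in (-T)..T, F (σ + y * Complex.I)) = 0 := by
    intro T
    have := Complex.integral_boundary_rect_eq_zero_of_differentiableOn F ⟨σ, -T⟩ ⟨1/2, T⟩ ?_
    · simpa only using this
    · intro s hs
      have hs1 := hs.1
      simp only [Set.mem_preimage, Set.uIcc_of_le h1, Set.mem_Icc] at hs1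
      have hsS : s ∈ gS := ⟨by linarith, hs1.2, by rintro rfl; simp at hs1; linarith⟩
      apply DifferentiableAt.differentiableWithinAt
      exact (gG_hasDerivAt c θ hsS).differentiableAt.mul (by fun_prop)
  have hor : ∀ ε : ℝ, (|ε| = 1) →
      Tendsto (fun T : ℝ => ∫ x : ℝ in σ..(1/2), F (x + (ε * T : ℝ) * Complex.I)) atTop (nhds 0) := by
    intro ε hε
    have hlim : Tendsto (fun T : ℝ => (C * Real.exp (L * (1/2))) * Real.exp (-(2 * T)) * |1/2 - σ|) atTop
        (nhds ((C * Real.exp (L * (1/2))) * 0 * |1/2 - σ|)) := by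
      refine (Tendsto.const_mul _ ?_).mul_const _
      refine Real.tendsto_exp_neg_atTop_nhds_zero.comp ?_
      exact tendsto_id.const_mul_atTop two_pos
    rw [mul_zero, zero_mul] at hlim
    refine squeeze_zero_norm' ?_ hlim
    filter_upwards [eventually_ge_atTop 1] with T hT
    apply intervalIntegral.norm_integral_le_of_norm_le_const
    intro x hx
    rw [Set.uIoc_of_le h1] at hx
    have habs : |ε * T| = T := by rw [abs_mul, hε, one_mul, abs_of_nonneg (by linarith)]
    have h2 := hb _ (gS_line (h0.trans hx.1) hx.2 (ε * T)) (by simpa [habs] using hT)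
    have h3 := line_bd (L := L) hC h2.1
    rw [habs] at h3
    refine h3.trans ?_
    have := hx.2
    gcongr
  have hv1 := intervalIntegral_tendsto_integral (line_int c θ hθ0 hθ1 (σ := 1/2) (by norm_num) le_rfl L).1
    tendsto_neg_atTop_atBot tendsto_id
  have hv2 := intervalIntegral_tendsto_integral (line_int c θ hθ0 hθ1 h0 h1 L).1
    tendsto_neg_atTop_atBot tendsto_id
  have hA := hor (-1) (by simp)
  have hB := hor 1 (by simp)
  simp only [neg_one_mul, one_mul] at hA hB
  have hall := ((hA.sub hB).add (hv1.const_smul Complex.I)).sub (hv2.const_smul Complex.I)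
  have hz := tendsto_nhds_unique hall ((tendsto_const_nhds (x := (0:ℂ))).congr fun T => (hrect T).symm)
  rw [sub_zero, zero_add, sub_eq_zero] at hz
  exact smul_right_injective ℂ Complex.I_ne_zero hz

lemma ibp_line (c θ : ℝ) (hθ0 : 0 < θ) (hθ1 : θ < 1) {σ : ℝ} (h0 : 0 < σ) (h1 : σ ≤ 1 / 2) (L : ℝ) :
    ∫ t : ℝ, gG1 c θ (σ + t * Complex.I) * Complex.exp (L * (σ + t * Complex.I)) =
    -L * ∫ t : ℝ, gG c θ (σ + t * Complex.I) * Complex.exp (L * (σ + t * Complex.I)) := by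
  obtain ⟨i1, i2⟩ := line_int c θ hθ0 hθ1 h0 h1 L
  have hd : ∀ t : ℝ, HasDerivAt
      (fun t : ℝ => gG c θ (σ + t * Complex.I) * Complex.exp (L * (σ + t * Complex.I)))
      (Complex.I * (gG1 c θ (σ + t * Complex.I) * Complex.exp (L * (σ + t * Complex.I)) +
        L * (gG c θ (σ + t * Complex.I) * Complex.exp (L * (σ + t * Complex.I))))) t := by
    intro t
    have a1 : HasDerivAt (fun t : ℝ => (σ + t * Complex.I : ℂ)) Complex.I t := by
      have := ((hasDerivAt_id t).ofReal_comp.mul_const Complex.I).const_add (σ : ℂ)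
      simpa using this
    have a2 := (gG_hasDerivAt c θ (gS_line h0 h1 t)).comp t a1
    have a3 := (a1.const_mul (L : ℂ)).cexp
    refine (a2.mul a3).congr_deriv ?_
    simp only [Function.comp]
    ring
  have hz := integral_eq_zero_of_hasDerivAt_of_integrable hd
    ((i2.add (i1.const_mul (L : ℂ))).const_mul Complex.I) i1
  rw [integral_const_mul, mul_eq_zero, or_iff_right Complex.I_ne_zero,
    integral_add i2 (i1.const_mul (L : ℂ)), integral_const_mul] at hz
  linear_combination hz

noncomputable def gJ (c θ L : ℝ) : ℂ := ∫ t : ℝ, gQ c θ ((1 + t * Complex.I) / L) *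
  ((1 + (t : ℂ) * Complex.I) ^ (-((2 - θ : ℝ) : ℂ)) * Complex.exp (1 + t * Complex.I))

lemma scaled_mem {L : ℝ} (hL : 2 ≤ L) (t : ℝ) : ((1 + t * Complex.I) / L : ℂ) ∈ gS := by
  have h0 : 0 < 1 / L := by positivity
  have h1 : 1 / L ≤ 1 / 2 := by gcongr
  have := gS_line h0 h1 (t / L)
  convert this using 1
  push_cast; ring

lemma scaled_int (a : ℝ) (ha : 1 < a) :
    Integrable (fun t : ℝ => (1 + (t : ℂ) * Complex.I) ^ (-(a : ℂ)) * Complex.exp (1 + t * Complex.I)) := by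
  refine (inv_int_aux a ha).mul_bdd (c := Real.exp 1) (by fun_prop) ?_
  refine Eventually.of_forall fun t => ?_
  rw [Complex.norm_exp]; simp

lemma scaled_cont (c θ : ℝ) {L : ℝ} (hL : 2 ≤ L) : Continuous (fun t : ℝ => gQ c θ ((1 + t * Complex.I) / L)) := by
  rw [continuous_iff_continuousAt]
  intro t
  have hs := scaled_mem hL t
  have hq : ContinuousAt (gQ c θ) ((1 + t * Complex.I) / L : ℂ) := by
    refine ((gG1_continuousAt c θ hs).add ?_).mul
      (continuousAt_id.cpow continuousAt_const (gS_slit hs))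
    exact ContinuousAt.div continuousAt_const (by fun_prop) (pow_ne_zero _ hs.2.2)
  exact ContinuousAt.comp (f := fun t : ℝ => ((1 + t * Complex.I) / L : ℂ)) hq (by fun_prop)

lemma gJ_tendsto (c θ : ℝ) (hθ0 : 0 < θ) (hθ1 : θ < 1) : Tendsto (gJ c θ) atTop
    (nhds (c * (θ - 1) * (2 * Real.pi / Real.Gamma (2 - θ)))) := by
  obtain ⟨C, hC⟩ := gQ_bounded c θ hθ0 hθ1
  have hint := scaled_int (2 - θ) (by linarith)
  rw [← inv_laplace (2 - θ) (by linarith), ← integral_const_mul]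
  refine tendsto_integral_filter_of_dominated_convergence
    (fun t : ℝ => C * ‖(1 + (t : ℂ) * Complex.I) ^ (-((2 - θ : ℝ) : ℂ)) * Complex.exp (1 + t * Complex.I)‖)
    ?_ ?_ (hint.norm.const_mul C) ?_
  · filter_upwards [eventually_ge_atTop 2] with L hL
    exact (scaled_cont c θ hL).aestronglyMeasurable.mul hint.aestronglyMeasurable
  · filter_upwards [eventually_ge_atTop 2] with L hL
    refine Eventually.of_forall fun t => ?_
    rw [norm_mul]
    gcongr
    exact hC _ (scaled_mem hL t)
  · refine Eventually.of_forall fun t => ?_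
    refine Tendsto.mul_const _ ?_
    refine (gQ_tendsto c θ hθ0 hθ1).comp ?_
    apply tendsto_nhdsWithin_of_tendsto_nhds_of_eventually_within
    · have h1 : Tendsto (fun L : ℝ => ((L⁻¹ : ℝ) : ℂ)) atTop (nhds ((0 : ℝ) : ℂ)) :=
        (Complex.continuous_ofReal.tendsto 0).comp tendsto_inv_atTop_zero
      have h2 := h1.const_mul (1 + t * Complex.I : ℂ)
      simp only [Complex.ofReal_zero, mul_zero, Complex.ofReal_inv] at h2
      simpa only [div_eq_mul_inv] using h2
    · filter_upwards [eventually_ge_atTop 2] with L hL using scaled_mem hL t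

lemma main_identity (c θ : ℝ) (hθ0 : 0 < θ) (hθ1 : θ < 1) {L : ℝ} (hL : 2 ≤ L) :
    ∫ t : ℝ, gG c θ ((1 / 2 : ℝ) + t * Complex.I) * Complex.exp (L * ((1 / 2 : ℝ) + t * Complex.I)) =
    2 * Real.pi - ((L ^ (-θ) : ℝ) : ℂ) * gJ c θ L := by
  have hLpos : 0 < L := by linarith
  have hL0 : (L : ℂ) ≠ 0 := by exact_mod_cast hLpos.ne'
  have h0 : 0 < 1 / L := by positivity
  have h1 : 1 / L ≤ 1 / 2 := by gcongr
  obtain ⟨C, hC⟩ := gQ_bounded c θ hθ0 hθ1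
  rw [shift_line c θ hθ0 hθ1 h0 h1 hLpos.le]
  have hibp := ibp_line c θ hθ0 hθ1 h0 h1 L
  have hsc := Measure.integral_comp_div (fun t : ℝ => gG1 c θ ((1 / L : ℝ) + t * Complex.I) *
    Complex.exp (L * ((1 / L : ℝ) + t * Complex.I))) L
  have hpt : ∀ t : ℝ, gG1 c θ ((1 / L : ℝ) + (t / L : ℝ) * Complex.I) *
      Complex.exp (L * ((1 / L : ℝ) + (t / L : ℝ) * Complex.I)) =
      ((L ^ (2 - θ) : ℝ) : ℂ) * (gQ c θ ((1 + t * Complex.I) / L) *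
        ((1 + (t : ℂ) * Complex.I) ^ (-((2 - θ : ℝ) : ℂ)) * Complex.exp (1 + t * Complex.I))) -
      (L : ℂ) ^ 2 * ((1 + (t : ℂ) * Complex.I) ^ (-((2 : ℝ) : ℂ)) * Complex.exp (1 + t * Complex.I)) := by
    intro t
    have e1 : (((1 / L : ℝ) : ℂ) + (t / L : ℝ) * Complex.I) = (1 + t * Complex.I) / L := by
      push_cast; ring
    have hs := scaled_mem hL t
    rw [e1, mul_div_cancel₀ _ hL0]
    set w : ℂ := 1 + t * Complex.I with hw
    have hw0 : w ≠ 0 := by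
      intro h
      have := congrArg Complex.re h
      simp [hw] at this
    have ep : (w / L) ^ (2 - (θ : ℂ)) = w ^ (((2 - θ : ℝ) : ℂ)) / ((L ^ (2 - θ) : ℝ) : ℂ) := by
      have : w = (L : ℂ) * (w / L) := by field_simp
      rw [eq_div_iff (by exact_mod_cast (Real.rpow_pos_of_pos hLpos _).ne')]
      conv_rhs => rw [this]
      have hwl : w / L ≠ 0 := div_ne_zero hw0 hL0
      rw [Complex.cpow_def_of_ne_zero hwl, Complex.cpow_def_of_ne_zero (mul_ne_zero hL0 hwl),
        Complex.log_ofReal_mul hLpos hwl, Complex.ofReal_cpow hLpos.le,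
        Complex.cpow_def_of_ne_zero hL0, ← Complex.ofReal_log hLpos.le, ← Complex.exp_add]
      congr 1
      push_cast
      ring
    have hwp : w ^ (((2 - θ : ℝ) : ℂ)) ≠ 0 := by simp [Complex.cpow_eq_zero_iff, hw0]
    have hLp : ((L ^ (2 - θ) : ℝ) : ℂ) ≠ 0 := by exact_mod_cast (Real.rpow_pos_of_pos hLpos _).ne'
    rw [gQ, ep, Complex.cpow_neg, Complex.cpow_neg]
    simp only [Complex.ofReal_ofNat, Complex.cpow_ofNat]
    field_simp
    ring
  simp_rw [hpt] at hsc
  have hJint : Integrable (fun t : ℝ => gQ c θ ((1 + t * Complex.I) / L) *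
      ((1 + (t : ℂ) * Complex.I) ^ (-((2 - θ : ℝ) : ℂ)) * Complex.exp (1 + t * Complex.I))) :=
    (scaled_int (2 - θ) (by linarith)).bdd_mul (c := C)
      (scaled_cont c θ hL).aestronglyMeasurable
      (Eventually.of_forall fun t => hC _ (scaled_mem hL t))
  rw [integral_sub (hJint.const_mul _)
    ((scaled_int 2 (by norm_num)).const_mul _), integral_const_mul,
    integral_const_mul, inv_laplace 2 (by norm_num), hibp, abs_of_pos hLpos, Complex.real_smul] at hsc
  change _ * gJ c θ L - _ = _ at hsc
  have eL : ((L ^ (2 - θ) : ℝ) : ℂ) = (L : ℂ) ^ 2 * ((L ^ (-θ) : ℝ) : ℂ) := by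
    rw [sub_eq_add_neg, Real.rpow_add hLpos]
    push_cast; simp
  have eG : Real.Gamma 2 = 1 := Real.Gamma_two
  rw [eL, eG] at hsc
  have hL2 : (L : ℂ) ^ 2 ≠ 0 := pow_ne_zero _ hL0
  apply mul_left_cancel₀ hL2
  simp only [Complex.ofReal_one, div_one] at hsc
  linear_combination hsc

theorem genExp_asymp_theta_in_unit_interval
    (c θ : ℝ) (hc : c ≠ 0) (hθ0 : 0 < θ) (hθ1 : θ < 1)
    (E : ℝ → ℂ)
    (hE : ∀ z : ℝ, 0 < z → E z = -(1 / (2 * Real.pi)) * ∫ t : ℝ,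
      Complex.exp ((c : ℂ) * (1 / 2 + t * Complex.I) ^ (θ : ℂ)) *
        (z : ℂ) ^ ((1 / 2 : ℂ) + t * Complex.I) *
        (↑Real.pi / Complex.sin (↑Real.pi * (1 / 2 + t * Complex.I)))) :
    (fun z : ℝ => E z -
        (-1 - ((c / Real.Gamma (1 - θ) : ℝ) : ℂ) * ((Real.log z ^ (-θ) : ℝ) : ℂ)))
      =o[atTop] fun z : ℝ => Real.log z ^ (-θ) := by
  have hpi : (Real.pi : ℂ) ≠ 0 := by exact_mod_cast Real.pi_ne_zero
  have hGp : 0 < Real.Gamma (1 - θ) := Real.Gamma_pos_of_pos (by linarith)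
  have hG0 : (Real.Gamma (1 - θ) : ℂ) ≠ 0 := by exact_mod_cast hGp.ne'
  have hG2 : Real.Gamma (2 - θ) = (1 - θ) * Real.Gamma (1 - θ) := by
    rw [← Real.Gamma_add_one (by linarith)]; ring_nf
  have hθc : (1 - (θ : ℂ)) ≠ 0 := by exact_mod_cast (by linarith : (1 - θ) ≠ 0)
  have hlim : Tendsto (fun z : ℝ => gJ c θ (Real.log z) / (2 * Real.pi) +
      ((c / Real.Gamma (1 - θ) : ℝ) : ℂ)) atTop (nhds 0) := by
    have h := (((gJ_tendsto c θ hθ0 hθ1).comp Real.tendsto_log_atTop).div_const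
      (2 * Real.pi : ℂ)).add_const ((c / Real.Gamma (1 - θ) : ℝ) : ℂ)
    have e : (c * (θ - 1) * (2 * Real.pi / Real.Gamma (2 - θ)) : ℂ) / (2 * Real.pi) +
        ((c / Real.Gamma (1 - θ) : ℝ) : ℂ) = 0 := by
      rw [hG2]
      push_cast
      field_simp
      ring
    rw [e] at h
    exact h
  have hEq : ∀ᶠ z : ℝ in atTop, E z -
        (-1 - ((c / Real.Gamma (1 - θ) : ℝ) : ℂ) * ((Real.log z ^ (-θ) : ℝ) : ℂ)) =
      (gJ c θ (Real.log z) / (2 * Real.pi) + ((c / Real.Gamma (1 - θ) : ℝ) : ℂ)) *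
        ((Real.log z ^ (-θ) : ℝ) : ℂ) := by
    filter_upwards [Real.tendsto_log_atTop.eventually_ge_atTop 2, eventually_gt_atTop 0] with z hz hz0
    have hz0' : (z : ℂ) ≠ 0 := by exact_mod_cast hz0.ne'
    have hm := main_identity c θ hθ0 hθ1 hz
    have hcongr : (fun t : ℝ => Complex.exp ((c : ℂ) * (1 / 2 + t * Complex.I) ^ (θ : ℂ)) *
        (z : ℂ) ^ ((1 / 2 : ℂ) + t * Complex.I) *
        (↑Real.pi / Complex.sin (↑Real.pi * (1 / 2 + t * Complex.I)))) =
        fun t : ℝ => gG c θ ((1 / 2 : ℝ) + t * Complex.I) *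
          Complex.exp (Real.log z * ((1 / 2 : ℝ) + t * Complex.I)) := by
      funext t
      rw [Complex.cpow_def_of_ne_zero hz0', ← Complex.ofReal_log hz0.le, gG]
      push_cast
      ring
    rw [hE z hz0, hcongr, hm]
    field_simp
    ring
  have hO : (fun z : ℝ => (gJ c θ (Real.log z) / (2 * Real.pi) +
      ((c / Real.Gamma (1 - θ) : ℝ) : ℂ)) * ((Real.log z ^ (-θ) : ℝ) : ℂ)) =o[atTop]
      fun z : ℝ => Real.log z ^ (-θ) := by
    have h1 := ((isLittleO_one_iff ℝ).2 hlim).mul_isBigO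
      (isBigO_refl (fun z : ℝ => ((Real.log z ^ (-θ) : ℝ) : ℂ)) atTop).norm_right
    refine h1.trans_isBigO ?_
    refine IsBigO.of_bound 1 (Eventually.of_forall fun z => ?_)
    simp
  exact hO.congr' (hEq.mono fun z hz => hz.symm) EventuallyEq.rfl
end
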